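/- For any recursively enumerable set Σ of 𝓛-sentences, the set {φ : Σ ⊨ φ} of 𝓛-formulas that are logical consequences of Σ is recursively enumerable. -/

import Mathlib

/-!
Formalization of the framework of "A machine that knows its own code" (S. Alexander).

The language 𝓛 is the language of Peano arithmetic (constant `0`, unary successor `S`,
binary `+` and `·`) extended by a unary modal operator `K`.
-/

/-- Terms of the language 𝓛 of Peano arithmetic (variables are indexed by `ℕ`). -/
inductive LTerm : Type
  | var : ℕ → LTerm
  | zero : LTerm
  | succ : LTerm → LTerm
  | add : LTerm → LTerm → LTerm
  | mul : LTerm → LTerm → LTerm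
  deriving DecidableEq

/-- Formulas of 𝓛: atomic equalities, falsum, implication, universal quantification,
and the modal operator `K`.  Other connectives and `∃` are defined below. -/
inductive LFormula : Type
  | eq : LTerm → LTerm → LFormula
  | falsum : LFormula
  | imp : LFormula → LFormula → LFormula
  | all : ℕ → LFormula → LFormula
  | K : LFormula → LFormula
  deriving DecidableEq

namespace LTerm

/-- Variables occurring in a term. -/
def fv : LTerm → Finset ℕ
  | var n => {n}
  | zero => ∅
  | succ t => t.fv
  | add t u => t.fv ∪ u.fv
  | mul t u => t.fv ∪ u.fv

/-- Simultaneous substitution of terms for variables in a term. -/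
def subst (s : ℕ → LTerm) : LTerm → LTerm
  | var n => s n
  | zero => zero
  | succ t => succ (t.subst s)
  | add t u => add (t.subst s) (u.subst s)
  | mul t u => mul (t.subst s) (u.subst s)

end LTerm

/-- The numeral `n̄` for a natural number `n`. -/
def numeral : ℕ → LTerm
  | 0 => LTerm.zero
  | n + 1 => LTerm.succ (numeral n)

namespace LFormula

/-- The free variables of a formula (the free variables of `K φ` are those of `φ`). -/
def fv : LFormula → Finset ℕ
  | eq t u => t.fv ∪ u.fv
  | falsum => ∅
  | imp a b => a.fv ∪ b.fv
  | all x a => a.fv.erase x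
  | K a => a.fv

/-- Simultaneous substitution of terms for the *free* variables of a formula
(bound variables are left untouched; the substitution is not capture-avoiding). -/
def subst (s : ℕ → LTerm) : LFormula → LFormula
  | eq t u => eq (t.subst s) (u.subst s)
  | falsum => falsum
  | imp a b => imp (a.subst s) (b.subst s)
  | all x a => all x (a.subst fun z => if z = x then LTerm.var x else s z)
  | K a => K (a.subst s)

end LFormula

/-- `subst1 x t φ` is `φ(x|t)`, the result of substituting the term `t` for the free
occurrences of the variable `x` in `φ`. -/
def subst1 (x : ℕ) (t : LTerm) (φ : LFormula) : LFormula :=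
  φ.subst fun z => if z = x then t else LTerm.var z

/-- `instNum s φ` is `φ^s`: the sentence obtained from `φ` by replacing each free
variable `x` of `φ` by the numeral for `s x`. -/
def instNum (s : ℕ → ℕ) (φ : LFormula) : LFormula :=
  φ.subst fun z => numeral (s z)

/-- `SubstitutableVar y x φ`: the variable `y` is substitutable for the variable `x`
in `φ` (no free occurrence of `x` lies within the scope of a quantifier binding `y`). -/
def SubstitutableVar (y x : ℕ) : LFormula → Prop
  | .eq _ _ => True
  | .falsum => True
  | .imp a b => SubstitutableVar y x a ∧ SubstitutableVar y x b
  | .all z a => x ∉ (LFormula.all z a).fv ∨ (y ≠ z ∧ SubstitutableVar y x a)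
  | .K a => SubstitutableVar y x a

/-- Correspondence of variables relative to a list of pairs of bound variables. -/
def VarCorr : List (ℕ × ℕ) → ℕ → ℕ → Prop
  | [], x, y => x = y
  | (a, b) :: Γ, x, y => (x = a ∧ y = b) ∨ (x ≠ a ∧ y ≠ b ∧ VarCorr Γ x y)

/-- Alpha-correspondence of terms relative to a list of pairs of bound variables. -/
def TermAlpha (Γ : List (ℕ × ℕ)) : LTerm → LTerm → Prop
  | .var x, .var y => VarCorr Γ x y
  | .zero, .zero => True
  | .succ t, .succ u => TermAlpha Γ t u
  | .add t₁ t₂, .add u₁ u₂ => TermAlpha Γ t₁ u₁ ∧ TermAlpha Γ t₂ u₂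
  | .mul t₁ t₂, .mul u₁ u₂ => TermAlpha Γ t₁ u₁ ∧ TermAlpha Γ t₂ u₂
  | _, _ => False

/-- Alpha-correspondence of formulas relative to a list of pairs of bound variables. -/
def FormulaAlpha : List (ℕ × ℕ) → LFormula → LFormula → Prop
  | Γ, .eq t₁ t₂, .eq u₁ u₂ => TermAlpha Γ t₁ u₁ ∧ TermAlpha Γ t₂ u₂
  | _, .falsum, .falsum => True
  | Γ, .imp a₁ a₂, .imp b₁ b₂ => FormulaAlpha Γ a₁ b₁ ∧ FormulaAlpha Γ a₂ b₂
  | Γ, .all x a, .all y b => FormulaAlpha ((x, y) :: Γ) a b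
  | Γ, .K a, .K b => FormulaAlpha Γ a b
  | _, _, _ => False

/-- `ψ` is an alphabetic variant of `φ`: `ψ` is obtained from `φ` by renaming bound
variables so as to respect the binding of the quantifiers. -/
def AlphaVariant (φ ψ : LFormula) : Prop := FormulaAlpha [] φ ψ

/-- Negation, defined from `→` and `⊥`. -/
def notF (φ : LFormula) : LFormula := LFormula.imp φ LFormula.falsum

/-- Conjunction (defined connective). -/
def andF (φ ψ : LFormula) : LFormula := notF (LFormula.imp φ (notF ψ))

/-- Biconditional (defined connective). -/
def iffF (φ ψ : LFormula) : LFormula := andF (LFormula.imp φ ψ) (LFormula.imp ψ φ)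

/-- Existential quantification (defined). -/
def exF (x : ℕ) (φ : LFormula) : LFormula := notF (LFormula.all x (notF φ))

/-- A canonical universal closure of a formula. -/
def uclose (φ : LFormula) : LFormula :=
  (φ.fv.sort (· ≤ ·)).foldr LFormula.all φ

/-- An 𝓛-structure: a first-order structure for the first-order part of 𝓛, together
with a truth assignment `satK s φ` for the purely modal formulas `K φ` at each
assignment `s` into the universe (the three required constraints are singled out
in `IsLStructure` below). -/
structure LStructure where
  U : Type
  nonempty : Nonempty U
  zero : U
  succ : U → U
  add : U → U → U
  mul : U → U → U
  satK : (ℕ → U) → LFormula → Prop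

namespace LStructure

/-- Value of a term under an assignment. -/
def evalT (M : LStructure) (s : ℕ → M.U) : LTerm → M.U
  | .var n => s n
  | .zero => M.zero
  | .succ t => M.succ (M.evalT s t)
  | .add t u => M.add (M.evalT s t) (M.evalT s u)
  | .mul t u => M.mul (M.evalT s t) (M.evalT s u)

/-- Satisfaction `M ⊨ φ[s]`, defined by the usual induction on formula complexity,
with `M ⊨ (K φ)[s]` given by the structure's truth assignment `satK`. -/
def Sat (M : LStructure) : (ℕ → M.U) → LFormula → Prop
  | s, .eq t u => M.evalT s t = M.evalT s u
  | _, .falsum => False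
  | s, .imp a b => M.Sat s a → M.Sat s b
  | s, .all x a => ∀ u : M.U, M.Sat (Function.update s x u) a
  | s, .K a => M.satK s a

/-- `M ⊨ φ`: `M ⊨ φ[s]` for every assignment `s`. -/
def Models (M : LStructure) (φ : LFormula) : Prop := ∀ s : ℕ → M.U, M.Sat s φ

end LStructure

/-- The three constraints making an `LStructure` a genuine 𝓛-structure of the base
logic: (a) `satK s φ` depends only on the values of `s` on the free variables of `φ`;
(b) invariance under alphabetic variants; (c) weak substitution. -/
def IsLStructure (M : LStructure) : Prop :=
  (∀ (φ : LFormula) (s t : ℕ → M.U), (∀ x ∈ φ.fv, s x = t x) →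
      (M.satK s φ ↔ M.satK t φ)) ∧
  (∀ (φ ψ : LFormula) (s : ℕ → M.U), AlphaVariant φ ψ →
      (M.satK s φ ↔ M.satK s ψ)) ∧
  (∀ (φ : LFormula) (x y : ℕ) (s : ℕ → M.U), SubstitutableVar y x φ →
      (M.satK s (subst1 x (LTerm.var y) φ) ↔ M.satK (Function.update s x (s y)) φ))

/-- `Σ ⊨ φ`: every 𝓛-structure satisfying every member of `Σ` satisfies `φ`. -/
def Consequence (T : Set LFormula) (φ : LFormula) : Prop :=
  ∀ M : LStructure, IsLStructure M → (∀ σ ∈ T, M.Models σ) → M.Models φ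

/-- `φ` is valid: `∅ ⊨ φ`, i.e. `φ` holds in every 𝓛-structure under every assignment. -/
def Valid (φ : LFormula) : Prop := Consequence ∅ φ

/-- The structure `M_Σ`: universe `ℕ`, standard interpretations of the symbols of
Peano arithmetic, and `M_Σ ⊨ (K φ)[s]` iff `Σ ⊨ φ^s`. -/
def MSigma (T : Set LFormula) : LStructure where
  U := ℕ
  nonempty := ⟨0⟩
  zero := 0
  succ := Nat.succ
  add := (· + ·)
  mul := (· * ·)
  satK := fun s φ => Consequence T (instNum s φ)

/-- Instances of the schema `E1`: the universal closure of `K φ` for valid `φ`. -/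
def E1set : Set LFormula :=
  {χ | ∃ φ : LFormula, Valid φ ∧ χ = uclose (LFormula.K φ)}

/-- Instances of the schema `E2`: the universal closure of `K(φ → ψ) → K φ → K ψ`. -/
def E2set : Set LFormula :=
  {χ | ∃ φ ψ : LFormula,
    χ = uclose (LFormula.imp (LFormula.K (LFormula.imp φ ψ))
      (LFormula.imp (LFormula.K φ) (LFormula.K ψ)))}

/-- Instances of the schema `E3` (factivity): the universal closure of `K φ → φ`. -/
def E3set : Set LFormula :=
  {χ | ∃ φ : LFormula, χ = uclose (LFormula.imp (LFormula.K φ) φ)}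

/-- Instances of the schema `E4`: the universal closure of `K φ → K K φ`. -/
def E4set : Set LFormula :=
  {χ | ∃ φ : LFormula, χ = uclose (LFormula.imp (LFormula.K φ) (LFormula.K (LFormula.K φ)))}

/-- The axioms of Peano arithmetic for 𝓛: the six usual axioms for successor,
addition and multiplication, and the induction schema extended to all 𝓛-formulas. -/
inductive PAax : LFormula → Prop
  | succ_ne_zero : PAax (.all 0 (notF (.eq (.succ (.var 0)) .zero)))
  | succ_inj : PAax (.all 0 (.all 1 (.imp (.eq (.succ (.var 0)) (.succ (.var 1)))
      (.eq (.var 0) (.var 1)))))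
  | add_zero : PAax (.all 0 (.eq (.add (.var 0) .zero) (.var 0)))
  | add_succ : PAax (.all 0 (.all 1 (.eq (.add (.var 0) (.succ (.var 1)))
      (.succ (.add (.var 0) (.var 1))))))
  | mul_zero : PAax (.all 0 (.eq (.mul (.var 0) .zero) .zero))
  | mul_succ : PAax (.all 0 (.all 1 (.eq (.mul (.var 0) (.succ (.var 1)))
      (.add (.mul (.var 0) (.var 1)) (.var 0)))))
  | ind (φ : LFormula) (x : ℕ) :
      PAax (uclose (.imp (subst1 x .zero φ)
        (.imp (.all x (.imp φ (subst1 x (.succ (.var x)) φ))) (.all x φ))))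

/-- The set of axioms of Peano arithmetic for 𝓛. -/
def PAset : Set LFormula := {φ | PAax φ}

/-- `W e`: the `e`-th recursively enumerable subset of `ℕ` (the domain of the `e`-th
partial computable function). -/
def W (e : ℕ) : Set ℕ :=
  {m | ((Denumerable.ofNat Nat.Partrec.Code e).eval m).Dom}

namespace LTerm

/-- A canonical Gödel numbering of terms. -/
def gnum : LTerm → ℕ
  | var n => Nat.pair 0 n
  | zero => Nat.pair 1 0
  | succ t => Nat.pair 2 t.gnum
  | add t u => Nat.pair 3 (Nat.pair t.gnum u.gnum)
  | mul t u => Nat.pair 4 (Nat.pair t.gnum u.gnum)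

end LTerm

namespace LFormula

/-- A canonical Gödel numbering `⌜φ⌝` of formulas. -/
def gnum : LFormula → ℕ
  | eq t u => Nat.pair 0 (Nat.pair t.gnum u.gnum)
  | falsum => Nat.pair 1 0
  | imp a b => Nat.pair 2 (Nat.pair a.gnum b.gnum)
  | all x a => Nat.pair 3 (Nat.pair x a.gnum)
  | K a => Nat.pair 4 a.gnum

end LFormula

/-- The designated variable `x`. -/
def vx : ℕ := 0
/-- The designated variable `y` (second pairing argument). -/
def vy : ℕ := 1
/-- The designated variable `e` (r.e. index). -/
def ve : ℕ := 2

/-- A formula is `K`-free (purely first-order) if the operator `K` does not occur in it. -/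
def KFree : LFormula → Prop
  | .eq _ _ => True
  | .falsum => True
  | .imp a b => KFree a ∧ KFree b
  | .all _ a => KFree a
  | .K _ => False

/-- The standard structure: universe `ℕ` with the standard interpretations of the
symbols of Peano arithmetic (the modal component is irrelevant for `K`-free formulas). -/
def StdModel : LStructure where
  U := ℕ
  nonempty := ⟨0⟩
  zero := 0
  succ := Nat.succ
  add := (· + ·)
  mul := (· * ·)
  satK := fun _ _ => False

/-- `pwNum pw a b k`: the result of substituting the numerals `ā`, `b̄`, `k̄` for the
designated variables `x`, `y`, `e` in the formula `pw` (read: `⟨ā, b̄⟩ ∈ W_k̄`). -/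
def pwNum (pw : LFormula) (a b k : ℕ) : LFormula :=
  instNum (fun z => if z = vx then a else if z = vy then b else k) pw

/-- `wNum w a k`: the result of substituting the numerals `ā`, `k̄` for the designated
variables `x`, `e` in the formula `w` (read: `ā ∈ W_k̄`). -/
def wNum (w : LFormula) (a k : ℕ) : LFormula :=
  instNum (fun z => if z = vx then a else k) w

/-- Line 3 of the definition of `Σ(n)`: the sentence
`∀x (K φ ↔ ⟨x, ⌜φ⌝⟩ ∈ W_n̄)`, where `pw` is the formula (with designated free
variables `x`, `y`, `e`) expressing `⟨x, y⟩ ∈ W_e`. -/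
def line3 (pw : LFormula) (n : ℕ) (φ : LFormula) : LFormula :=
  LFormula.all vx (iffF (LFormula.K φ)
    (subst1 ve (numeral n) (subst1 vy (numeral φ.gnum) pw)))

/-- Membership in the axiom set `Σ(n)` (relative to the formula `pw` expressing
`⟨x, y⟩ ∈ W_e`): (1) instances of `E1`, `E2`, `E4`; (2) the axioms of Peano
arithmetic for 𝓛; (3) `∀x (K φ ↔ ⟨x, ⌜φ⌝⟩ ∈ W_n̄)` for `φ` with free variables
⊆ {x}; (4) assigned validity `φ^s` for valid `φ`; (5) `K φ` for `φ` an instance of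
lines 1–4 or, recursively, of line 5. -/
inductive SigmaAx (pw : LFormula) (n : ℕ) : LFormula → Prop
  | e1 {χ : LFormula} (h : χ ∈ E1set) : SigmaAx pw n χ
  | e2 {χ : LFormula} (h : χ ∈ E2set) : SigmaAx pw n χ
  | e4 {χ : LFormula} (h : χ ∈ E4set) : SigmaAx pw n χ
  | pa {χ : LFormula} (h : PAax χ) : SigmaAx pw n χ
  | code (φ : LFormula) (h : φ.fv ⊆ {vx}) : SigmaAx pw n (line3 pw n φ)
  | av (φ : LFormula) (s : ℕ → ℕ) (h : Valid φ) : SigmaAx pw n (instNum s φ)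
  | k {φ : LFormula} (h : SigmaAx pw n φ) : SigmaAx pw n (LFormula.K φ)

/-- The axiom set `Σ(n)` (relative to `pw`). -/
def SigmaN (pw : LFormula) (n : ℕ) : Set LFormula := {φ | SigmaAx pw n φ}

/-- The set `{ ⟨m, ⌜φ⌝⟩ : φ an 𝓛-formula with free variables ⊆ {x} and
Σ(n) ⊨ φ(x|m̄) }`. -/
def goalSet (pw : LFormula) (n : ℕ) : Set ℕ :=
  {p | ∃ (m : ℕ) (φ : LFormula), p = Nat.pair m φ.gnum ∧ φ.fv ⊆ {vx} ∧
    Consequence (SigmaN pw n) (subst1 vx (numeral m) φ)}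

/-- A propositional clause over atoms indexed by `ℕ`: a list of hypotheses and a list of
alternative conclusions. -/
abbrev Clause : Type := List ℕ × List ℕ

namespace Clause

/-- The disjunction of a list of atoms. -/
def disj (v : ℕ → Prop) : List ℕ → Prop
  | [] => False
  | [c] => v c
  | c :: d :: cs => v c ∨ disj v (d :: cs)

/-- The iterated implication from a list of atoms to a disjunction of atoms. -/
def impl (v : ℕ → Prop) : List ℕ → List ℕ → Prop
  | [], cs => disj v cs
  | h :: hs, cs => v h → impl v hs cs

/-- Truth of a clause under a valuation. -/
def Holds (v : ℕ → Prop) (c : Clause) : Prop := impl v c.1 c.2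

theorem disj_iff {v : ℕ → Prop} : ∀ {cs : List ℕ}, disj v cs ↔ ∃ c ∈ cs, v c
  | [] => by simp [disj]
  | [c] => by simp [disj]
  | c :: d :: cs => by simp [disj, disj_iff (cs := d :: cs)]

theorem holds_iff {v : ℕ → Prop} {c : Clause} :
    Holds v c ↔ ((∀ h ∈ c.1, v h) → ∃ d ∈ c.2, v d) := by
  obtain ⟨hs, cs⟩ := c
  induction hs with
  | nil => simp [Holds, impl, disj_iff]
  | cons h hs ih =>
    simp only [Holds] at ih
    simp [Holds, impl, ih, and_imp]

/-- For `b = (n, m)`, the valuation given by the binary digits of `m` falsifies the clause `c`,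
all of whose atoms are below `n`. -/
def Falsified (c : Clause) (b : ℕ × ℕ) : Prop :=
  (∀ h ∈ c.1, h < b.1 ∧ b.2 / 2 ^ h % 2 = 1) ∧ ∀ h ∈ c.2, h < b.1 ∧ b.2 / 2 ^ h % 2 = 0

/-- Every valuation of the atoms below `n` falsifies one of the first `n` clauses. -/
def RefutedAt (c : ℕ → ℕ → Clause) (k n : ℕ) : Prop :=
  ∀ m < 2 ^ n, ∃ i < n, Falsified (c k i) (n, m)

theorem primrecRel_falsified : PrimrecRel Falsified := by
  have hpow : Primrec₂ ((· ^ ·) : ℕ → ℕ → ℕ) := Primrec₂.unpaired'.1 Nat.Primrec.pow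
  have key (r : ℕ) :
      PrimrecRel fun (h : ℕ) (b : ℕ × ℕ) => h < b.1 ∧ b.2 / 2 ^ h % 2 = r := by
    refine PrimrecPred.and ?_ ?_
    · exact Primrec.nat_lt.comp Primrec.fst (Primrec.fst.comp Primrec.snd)
    · exact Primrec.eq.comp
        (Primrec.nat_mod.comp (Primrec.nat_div.comp (Primrec.snd.comp Primrec.snd)
          (hpow.comp (Primrec.const 2) Primrec.fst)) (Primrec.const 2)) (Primrec.const r)
  exact PrimrecPred.and
    ((key 1).forall_mem_list.comp (Primrec.fst.comp Primrec.fst) Primrec.snd)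
    ((key 0).forall_mem_list.comp (Primrec.snd.comp Primrec.fst) Primrec.snd)

theorem primrecRel_refutedAt {c : ℕ → ℕ → Clause} (hc : Primrec₂ c) :
    PrimrecRel (RefutedAt c) := by
  have hpow : Primrec₂ ((· ^ ·) : ℕ → ℕ → ℕ) := Primrec₂.unpaired'.1 Nat.Primrec.pow
  have h1 : PrimrecRel fun (i : ℕ) (b : ℕ × ℕ × ℕ) => Falsified (c b.1 i) b.2 :=
    primrecRel_falsified.comp
      (hc.comp (Primrec.fst.comp Primrec.snd) Primrec.fst) (Primrec.snd.comp Primrec.snd)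
  have h2 : PrimrecRel fun (m : ℕ) (b : ℕ × ℕ) =>
      ∃ i < b.2, Falsified (c b.1 i) (b.2, m) :=
    (h1.exists_mem_list.comp (Primrec.list_range.comp (Primrec.snd.comp Primrec.snd))
      (Primrec.pair (Primrec.fst.comp Primrec.snd)
        (Primrec.pair (Primrec.snd.comp Primrec.snd) Primrec.fst))).of_eq fun _ => by simp
  exact (h2.forall_mem_list.comp
    (Primrec.list_range.comp (hpow.comp (Primrec.const 2) Primrec.snd))
    (Primrec.pair Primrec.fst Primrec.snd)).of_eq fun _ => by simp [RefutedAt]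

theorem falsified_iff {c : Clause} {n m : ℕ} :
    Falsified c (n, m) ↔
      (∀ h ∈ c.1 ++ c.2, h < n) ∧ ¬ Holds (fun a => m.testBit a = true) c := by
  simp only [Falsified, holds_iff, Nat.testBit_eq_decide_div_mod_eq, List.mem_append,
    decide_eq_true_eq]
  push Not
  constructor
  · rintro ⟨h1, h2⟩
    refine ⟨fun h hh => hh.elim (fun hh => (h1 h hh).1) fun hh => (h2 h hh).1,
      fun h hh => (h1 h hh).2, fun h hh => ?_⟩
    have := (h2 h hh).2
    omega
  · rintro ⟨h1, h2, h3⟩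
    refine ⟨fun h hh => ⟨h1 h (.inl hh), h2 h hh⟩, fun h hh => ⟨h1 h (.inr hh), ?_⟩⟩
    have := h3 h hh
    omega

theorem holds_congr {v w : ℕ → Prop} {c : Clause} (h : ∀ a ∈ c.1 ++ c.2, (v a ↔ w a)) :
    Holds v c ↔ Holds w c := by
  simp only [List.mem_append] at h
  rw [holds_iff, holds_iff]
  refine imp_congr (forall₂_congr fun a ha => h a (.inl ha)) (exists_congr fun a => ?_)
  exact and_congr_right fun ha => h a (.inr ha)

/-- The set of valuations satisfying a clause is closed. -/
theorem isClosed_holds (c : Clause) : IsClosed {v : ℕ → Bool | Holds (fun a => v a = true) c} := by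
  have atom (a : ℕ) : IsClopen {v : ℕ → Bool | v a = true} :=
    (isClopen_discrete {true}).preimage (continuous_apply a)
  obtain ⟨hs, cs⟩ := c
  suffices h : IsClopen {v : ℕ → Bool | Holds (fun a => v a = true) (hs, cs)} from h.1
  induction hs with
  | nil =>
    simp only [Holds, impl, disj_iff]
    induction cs with
    | nil => simp [isClopen_empty]
    | cons d cs ih => simpa [Set.ofPred_or] using (atom d).union ih
  | cons h hs ih =>
    have : {v : ℕ → Bool | Holds (fun a => v a = true) (h :: hs, cs)} =
        {v : ℕ → Bool | v h = true}ᶜ ∪ {v : ℕ → Bool | Holds (fun a => v a = true) (hs, cs)} := by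
      ext v
      simp only [Holds, impl, Set.mem_ofPred_eq, Set.mem_union, Set.mem_compl_iff, imp_iff_not_or]
    rw [this]
    exact (atom h).compl.union ih

/-- Compactness of propositional logic. -/
theorem exists_refutedAt_iff {c : ℕ → ℕ → Clause} {k : ℕ} :
    (∃ n, RefutedAt c k n) ↔ ¬ ∃ v : ℕ → Prop, ∀ i, Holds v (c k i) := by
  classical
  constructor
  · rintro ⟨n, hn⟩ ⟨v, hv⟩
    obtain ⟨i, -, hi⟩ := hn (Nat.ofBits fun i : Fin n => decide (v i)) (Nat.ofBits_lt_two_pow _)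
    rw [falsified_iff] at hi
    refine hi.2 ((holds_congr fun a ha => ?_).1 (hv i))
    simp [Nat.testBit_ofBits_lt _ _ (hi.1 a ha)]
  · intro h
    obtain ⟨t, ht⟩ := isCompact_univ.elim_finite_subfamily_closed
      (fun i => {v : ℕ → Bool | Holds (fun a => v a = true) (c k i)})
      (fun i => isClosed_holds _) (by
        rw [Set.univ_inter, Set.eq_empty_iff_forall_notMem]
        exact fun v hv => h ⟨_, fun i => Set.mem_iInter.1 hv i⟩)
    rw [Set.univ_inter, Set.eq_empty_iff_forall_notMem] at ht
    refine ⟨(t.sup fun i => i + 1) + t.sup fun i => ((c k i).1 ++ (c k i).2).sum + 1,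
      fun m _ => ?_⟩
    have := ht m.testBit
    simp only [Set.mem_iInter, Set.mem_ofPred_eq, not_forall] at this
    obtain ⟨i, hi, hm⟩ := this
    have h1 : i + 1 ≤ t.sup fun i => i + 1 := Finset.le_sup (f := fun i => i + 1) hi
    have h2 : ((c k i).1 ++ (c k i).2).sum + 1 ≤
        t.sup fun i => ((c k i).1 ++ (c k i).2).sum + 1 :=
      Finset.le_sup (f := fun i => ((c k i).1 ++ (c k i).2).sum + 1) hi
    refine ⟨i, by omega, falsified_iff.2 ⟨fun a ha => ?_, hm⟩⟩
    have := List.le_sum_of_mem ha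
    omega

/-- Unsatisfiability of a primitive recursive family of clauses is recursively enumerable. -/
theorem exists_code_unsatisfiable {c : ℕ → ℕ → Clause} (hc : Primrec₂ c) :
    ∃ e : Nat.Partrec.Code, ∀ k, (e.eval k).Dom ↔ ¬ ∃ v : ℕ → Prop, ∀ i, Holds v (c k i) := by
  classical
  have h1 : Computable₂ fun k n => decide (RefutedAt c k n) :=
    (primrecRel_refutedAt hc).decide.to_comp
  have h2 := Partrec.nat_iff.1 ((Partrec.rfind h1.partrec₂).map (Computable.const 0).to₂)
  obtain ⟨e, he⟩ := Nat.Partrec.Code.exists_code.1 h2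
  refine ⟨e, fun k => ?_⟩
  rw [he, ← exists_refutedAt_iff]
  simp [Part.map_Dom, Nat.rfind_dom]

end Clause

/-! ### Numerical codes -/

namespace Henkin

/-- Name of the value of `0`. -/
abbrev nmZero : ℕ := Nat.pair 0 0
/-- Name of the successor of the element named `d`. -/
abbrev nmSucc (d : ℕ) : ℕ := Nat.pair 1 d
/-- Name of a sum. -/
abbrev nmAdd (d e : ℕ) : ℕ := Nat.pair 2 (Nat.pair d e)
/-- Name of a product. -/
abbrev nmMul (d e : ℕ) : ℕ := Nat.pair 3 (Nat.pair d e)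
/-- Henkin witness for `∀ x, a` under the environment `e`. -/
abbrev nmWit (x a e : ℕ) : ℕ := Nat.pair 4 (Nat.pair x (Nat.pair a e))
/-- Name of the initial value of the variable `x`. -/
abbrev nmVar (x : ℕ) : ℕ := Nat.pair 5 x

/-- Code of the environment (or list of pairs of bound variables) `e` extended by `(x, d)`;
the code `0` stands for the initial environment (or empty list). -/
abbrev extend (x d e : ℕ) : ℕ := Nat.pair (Nat.pair x d) e + 1

abbrev tmVar (x : ℕ) : ℕ := Nat.pair 0 x
abbrev tmZero : ℕ := Nat.pair 1 0
abbrev tmSucc (t : ℕ) : ℕ := Nat.pair 2 t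
abbrev tmAdd (t u : ℕ) : ℕ := Nat.pair 3 (Nat.pair t u)
abbrev tmMul (t u : ℕ) : ℕ := Nat.pair 4 (Nat.pair t u)

abbrev fmEq (t u : ℕ) : ℕ := Nat.pair 0 (Nat.pair t u)
abbrev fmFalsum : ℕ := Nat.pair 1 0
abbrev fmImp (a b : ℕ) : ℕ := Nat.pair 2 (Nat.pair a b)
abbrev fmAll (x a : ℕ) : ℕ := Nat.pair 3 (Nat.pair x a)
abbrev fmK (a : ℕ) : ℕ := Nat.pair 4 a

/-- Code of the identity relation between free variables. -/
abbrev relId : ℕ := 0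
/-- Code of the relation between free variables given by substituting `y` for `x`. -/
abbrev relSub (x y : ℕ) : ℕ := Nat.pair 1 (Nat.pair x y)
/-- Code of the identity restricted to the variables on which the environments `e`, `e'`
agree. -/
abbrev relAgree (e e' : ℕ) : ℕ := Nat.pair 2 (Nat.pair e e')

/-- The atom: the names `d`, `e` denote the same element. -/
abbrev atEq (d e : ℕ) : ℕ := Nat.pair 0 (Nat.pair d e)
/-- The atom: `x ≠ y`. -/
abbrev atNe (x y : ℕ) : ℕ := Nat.pair 1 (Nat.pair x y)
/-- The atom: the term `t` has the value named `d` under the environment `e`. -/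
abbrev atVal (t e d : ℕ) : ℕ := Nat.pair 2 (Nat.pair t (Nat.pair e d))
/-- The atom: the variables `x`, `y` correspond with respect to the relation `r` between free
variables and the list `g` of pairs of bound variables. -/
abbrev atVar (r g x y : ℕ) : ℕ := Nat.pair 3 (Nat.pair (Nat.pair r g) (Nat.pair x y))
/-- The atom: the terms `t`, `u` correspond with respect to `r` and `g`. -/
abbrev atTerm (r g t u : ℕ) : ℕ := Nat.pair 4 (Nat.pair (Nat.pair r g) (Nat.pair t u))
/-- The atom: the formulas `a`, `b` correspond with respect to `r` and `g`. -/
abbrev atForm (r g a b : ℕ) : ℕ := Nat.pair 5 (Nat.pair (Nat.pair r g) (Nat.pair a b))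
/-- The atom: the formula `a` holds under the environment `e`. -/
abbrev atSat (a e : ℕ) : ℕ := Nat.pair 6 (Nat.pair a e)
/-- The atom: `a` is the code of a formula. -/
abbrev atIsForm (a : ℕ) : ℕ := atForm (relAgree 0 0) 0 a a

/-- Names of the clause schemes describing satisfaction in an 𝓛-structure. -/
inductive Rule : Type
  | neZeroSucc | neSuccZero | neSuccSucc
  | eqRefl | eqSymm | eqTrans | eqSucc | eqAdd | eqMul
  | valInit | valHere | valThere | valZero | valSucc | valAdd | valMul
  | varHere | varThere | varId | varSub | varSubNe | varAgree
  | termVar | termZero | termSucc | termAdd | termMul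
  | formEq | formFalsum | formImp | formAll | formAllId | formK
  | satEq | eqSat | satFalsum | impElim | impIntro | impCases | allElim | allIntro
  | satAgree | satAlpha | alphaSat | satSub | subSat
  deriving DecidableEq

/-- The instances of the clause schemes. -/
def clause : Rule → ℕ → ℕ → ℕ → ℕ → ℕ → ℕ → Clause
  | .neZeroSucc, x, _, _, _, _, _ => ([], [atNe 0 (x + 1)])
  | .neSuccZero, x, _, _, _, _, _ => ([], [atNe (x + 1) 0])
  | .neSuccSucc, x, y, _, _, _, _ => ([atNe x y], [atNe (x + 1) (y + 1)])
  | .eqRefl, d, _, _, _, _, _ => ([], [atEq d d])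
  | .eqSymm, d, e, _, _, _, _ => ([atEq d e], [atEq e d])
  | .eqTrans, d, e, f, _, _, _ => ([atEq d e, atEq e f], [atEq d f])
  | .eqSucc, d, e, _, _, _, _ => ([atEq d e], [atEq (nmSucc d) (nmSucc e)])
  | .eqAdd, d, e, d', e', _, _ => ([atEq d d', atEq e e'], [atEq (nmAdd d e) (nmAdd d' e')])
  | .eqMul, d, e, d', e', _, _ => ([atEq d d', atEq e e'], [atEq (nmMul d e) (nmMul d' e')])
  | .valInit, x, _, _, _, _, _ => ([], [atVal (tmVar x) 0 (nmVar x)])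
  | .valHere, x, d, e, _, _, _ => ([], [atVal (tmVar x) (extend x d e) d])
  | .valThere, x, y, d, d', e, _ =>
      ([atNe x y, atVal (tmVar x) e d], [atVal (tmVar x) (extend y d' e) d])
  | .valZero, e, _, _, _, _, _ => ([], [atVal tmZero e nmZero])
  | .valSucc, t, d, e, _, _, _ => ([atVal t e d], [atVal (tmSucc t) e (nmSucc d)])
  | .valAdd, t, u, d, d', e, _ =>
      ([atVal t e d, atVal u e d'], [atVal (tmAdd t u) e (nmAdd d d')])
  | .valMul, t, u, d, d', e, _ =>
      ([atVal t e d, atVal u e d'], [atVal (tmMul t u) e (nmMul d d')])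
  | .varHere, r, g, x, y, _, _ => ([], [atVar r (extend x y g) x y])
  | .varThere, r, g, x, y, u, w =>
      ([atNe u x, atNe w y, atVar r g u w], [atVar r (extend x y g) u w])
  | .varId, x, _, _, _, _, _ => ([], [atVar relId 0 x x])
  | .varSub, x, y, _, _, _, _ => ([], [atVar (relSub x y) 0 x y])
  | .varSubNe, x, y, u, _, _, _ => ([atNe u x], [atVar (relSub x y) 0 u u])
  | .varAgree, e, e', x, d, d', _ =>
      ([atVal (tmVar x) e d, atVal (tmVar x) e' d', atEq d d'], [atVar (relAgree e e') 0 x x])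
  | .termVar, r, g, x, y, _, _ => ([atVar r g x y], [atTerm r g (tmVar x) (tmVar y)])
  | .termZero, r, g, _, _, _, _ => ([], [atTerm r g tmZero tmZero])
  | .termSucc, r, g, t, u, _, _ => ([atTerm r g t u], [atTerm r g (tmSucc t) (tmSucc u)])
  | .termAdd, r, g, t, u, t', u' =>
      ([atTerm r g t t', atTerm r g u u'], [atTerm r g (tmAdd t u) (tmAdd t' u')])
  | .termMul, r, g, t, u, t', u' =>
      ([atTerm r g t t', atTerm r g u u'], [atTerm r g (tmMul t u) (tmMul t' u')])
  | .formEq, r, g, t, u, t', u' =>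
      ([atTerm r g t t', atTerm r g u u'], [atForm r g (fmEq t u) (fmEq t' u')])
  | .formFalsum, r, g, _, _, _, _ => ([], [atForm r g fmFalsum fmFalsum])
  | .formImp, r, g, a, b, a', b' =>
      ([atForm r g a a', atForm r g b b'], [atForm r g (fmImp a b) (fmImp a' b')])
  | .formAll, r, g, x, a, a', _ =>
      ([atForm r (extend x x g) a a'], [atForm r g (fmAll x a) (fmAll x a')])
  | .formAllId, g, x, y, a, a', _ =>
      ([atForm relId (extend x y g) a a'], [atForm relId g (fmAll x a) (fmAll y a')])
  | .formK, r, g, a, a', _, _ => ([atForm r g a a'], [atForm r g (fmK a) (fmK a')])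
  | .satEq, t, u, d, d', e, _ =>
      ([atVal t e d, atVal u e d', atSat (fmEq t u) e], [atEq d d'])
  | .eqSat, t, u, d, d', e, _ =>
      ([atVal t e d, atVal u e d', atEq d d'], [atSat (fmEq t u) e])
  | .satFalsum, e, _, _, _, _, _ => ([atSat fmFalsum e], [])
  | .impElim, a, b, e, _, _, _ => ([atSat (fmImp a b) e, atSat a e], [atSat b e])
  | .impIntro, a, b, e, _, _, _ => ([atIsForm a, atSat b e], [atSat (fmImp a b) e])
  | .impCases, a, b, e, _, _, _ =>
      ([atIsForm a, atIsForm b], [atSat (fmImp a b) e, atSat a e])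
  | .allElim, x, a, d, e, _, _ => ([atSat (fmAll x a) e], [atSat a (extend x d e)])
  | .allIntro, x, a, e, _, _, _ =>
      ([atSat a (extend x (nmWit x a e) e)], [atSat (fmAll x a) e])
  | .satAgree, a, e, e', _, _, _ =>
      ([atForm (relAgree e e') 0 a a, atSat (fmK a) e], [atSat (fmK a) e'])
  | .satAlpha, a, b, e, _, _, _ => ([atForm relId 0 a b, atSat (fmK a) e], [atSat (fmK b) e])
  | .alphaSat, a, b, e, _, _, _ => ([atForm relId 0 a b, atSat (fmK b) e], [atSat (fmK a) e])
  | .satSub, x, y, a, b, d, e =>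
      ([atForm (relSub x y) 0 a b, atVal (tmVar y) e d, atSat (fmK b) e],
        [atSat (fmK a) (extend x d e)])
  | .subSat, x, y, a, b, d, e =>
      ([atForm (relSub x y) 0 a b, atVal (tmVar y) e d, atSat (fmK a) (extend x d e)],
        [atSat (fmK b) e])

/-- A valuation satisfying all instances of the clause schemes. -/
def Closed (v : ℕ → Prop) : Prop :=
  ∀ (r : Rule) (a b c d e f : ℕ), Clause.Holds v (clause r a b c d e f)

theorem primrec_natPair {f g : ℕ → ℕ} (hf : Primrec f) (hg : Primrec g) :
    Primrec fun n => Nat.pair (f n) (g n) := Primrec₂.natPair.comp hf hg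

theorem primrec_listCons {f : ℕ → ℕ} {g : ℕ → List ℕ} (hf : Primrec f) (hg : Primrec g) :
    Primrec fun n => f n :: g n := Primrec.list_cons.comp hf hg

theorem primrec_add_one {f : ℕ → ℕ} (hf : Primrec f) : Primrec fun n => f n + 1 :=
  Primrec.succ.comp hf

theorem primrec_clause (r : Rule) {f₁ f₂ f₃ f₄ f₅ f₆ : ℕ → ℕ} (h₁ : Primrec f₁)
    (h₂ : Primrec f₂) (h₃ : Primrec f₃) (h₄ : Primrec f₄) (h₅ : Primrec f₅) (h₆ : Primrec f₆) :
    Primrec fun n => clause r (f₁ n) (f₂ n) (f₃ n) (f₄ n) (f₅ n) (f₆ n) := by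
  cases r <;> simp only [clause] <;>
    repeat with_reducible first
      | assumption
      | exact Primrec.const _
      | refine Primrec.pair ?_ ?_
      | refine primrec_listCons ?_ ?_
      | refine primrec_natPair ?_ ?_
      | refine primrec_add_one ?_

theorem exists_list_rule : ∃ l : List Rule, ∀ r, r ∈ l :=
  ⟨(List.range 46).map Rule.ofNat, fun r => by cases r <;> decide⟩

/-- The instance of a clause scheme with parameters coded by a single number. -/
def clauseAt (r : Rule) (n : ℕ) : Clause :=
  clause r n.unpair.1 n.unpair.2.unpair.1 n.unpair.2.unpair.2.unpair.1
    n.unpair.2.unpair.2.unpair.2.unpair.1 n.unpair.2.unpair.2.unpair.2.unpair.2.unpair.1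
    n.unpair.2.unpair.2.unpair.2.unpair.2.unpair.2

theorem primrec_clauseAt (r : Rule) : Primrec (clauseAt r) := by
  have h₁ : Primrec fun n : ℕ => n.unpair.1 := Primrec.fst.comp Primrec.unpair
  have h₂ : Primrec fun n : ℕ => n.unpair.2 := Primrec.snd.comp Primrec.unpair
  have r₂ := h₂.comp h₂
  have r₃ := h₂.comp r₂
  have r₄ := h₂.comp r₃
  exact primrec_clause r h₁ (h₁.comp h₂) (h₁.comp r₂) (h₁.comp r₃) (h₁.comp r₄) (h₂.comp r₄)

theorem forall_holds_clauseAt {v : ℕ → Prop} {r : Rule} :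
    (∀ n, Clause.Holds v (clauseAt r n)) ↔
      ∀ a b c d e f : ℕ, Clause.Holds v (clause r a b c d e f) := by
  refine ⟨fun h a b c d e f => ?_, fun h n => h _ _ _ _ _ _⟩
  simpa only [clauseAt, Nat.unpair_pair] using h (Nat.pair a (Nat.pair b (Nat.pair c
    (Nat.pair d (Nat.pair e f)))))

/-- The instances of finitely many clause schemes can be generated primitive recursively. -/
theorem exists_primrec_enum (rs : List Rule) : ∃ g : ℕ → Clause, Primrec g ∧
    ∀ v, (∀ i, Clause.Holds v (g i)) ↔ ∀ r ∈ rs, ∀ n, Clause.Holds v (clauseAt r n) := by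
  induction rs with
  | nil =>
    exact ⟨fun _ => ([0], [0]), Primrec.const _, fun v => by
      simp [Clause.Holds, Clause.impl, Clause.disj]⟩
  | cons r rs ih =>
    obtain ⟨g, hg, hv⟩ := ih
    have h₁ : Primrec fun n : ℕ => n.unpair.1 := Primrec.fst.comp Primrec.unpair
    have h₂ : Primrec fun n : ℕ => n.unpair.2 := Primrec.snd.comp Primrec.unpair
    refine ⟨fun n => if n.unpair.1 = 0 then g n.unpair.2 else clauseAt r n.unpair.2, ?_,
      fun v => ?_⟩
    · exact Primrec.ite (Primrec.eq.comp h₁ (Primrec.const 0)) (hg.comp h₂)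
        ((primrec_clauseAt r).comp h₂)
    · simp only [List.forall_mem_cons, ← hv]
      refine ⟨fun h => ⟨fun n => ?_, fun i => ?_⟩, fun h i => ?_⟩
      · simpa using h (Nat.pair 1 n)
      · simpa using h (Nat.pair 0 i)
      · split_ifs
        · exact h.2 _
        · exact h.1 _

theorem exists_primrec_closed : ∃ g : ℕ → Clause, Primrec g ∧
    ∀ v, (∀ i, Clause.Holds v (g i)) ↔ Closed v := by
  obtain ⟨l, hl⟩ := exists_list_rule
  obtain ⟨g, hg, hv⟩ := exists_primrec_enum l
  refine ⟨g, hg, fun v => (hv v).trans ?_⟩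
  simp only [hl, forall_const, forall_holds_clauseAt, Closed]

/-- The theory of the consequences of the sentences with codes in the domain of `q`, refuting
the formula with code `k`. -/
def theoryClause (g : ℕ → Clause) (q : Nat.Partrec.Code) (k n : ℕ) : Clause :=
  if n.unpair.1 = 0 then g n.unpair.2
  else if n.unpair.1 = 1 then ([atSat k 0], [])
  else if (q.evaln n.unpair.1 n.unpair.2.unpair.1).isSome then
    ([atIsForm k], [atSat n.unpair.2.unpair.1 n.unpair.2.unpair.2])
  else ([0], [0])

theorem primrec_theoryClause {g : ℕ → Clause} (hg : Primrec g) (q : Nat.Partrec.Code) :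
    Primrec₂ (theoryClause g q) := by
  have h₁ : Primrec fun p : ℕ × ℕ => p.2.unpair.1 :=
    Primrec.fst.comp (Primrec.unpair.comp Primrec.snd)
  have h₂ : Primrec fun p : ℕ × ℕ => p.2.unpair.2 :=
    Primrec.snd.comp (Primrec.unpair.comp Primrec.snd)
  have h₃ : Primrec fun p : ℕ × ℕ => p.2.unpair.2.unpair.1 :=
    Primrec.fst.comp (Primrec.unpair.comp h₂)
  have h₄ : Primrec fun p : ℕ × ℕ => p.2.unpair.2.unpair.2 :=
    Primrec.snd.comp (Primrec.unpair.comp h₂)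
  have hev : Primrec fun p : ℕ × ℕ => q.evaln p.2.unpair.1 p.2.unpair.2.unpair.1 :=
    Nat.Partrec.Code.primrec_evaln.comp
      (Primrec.pair (Primrec.pair h₁ (Primrec.const q)) h₃)
  have hk : Primrec fun p : ℕ × ℕ => p.1 := Primrec.fst
  have hsat {a e : ℕ × ℕ → ℕ} (ha : Primrec a) (he : Primrec e) :
      Primrec fun p => [atSat (a p) (e p)] :=
    Primrec.list_cons.comp (Primrec₂.natPair.comp (Primrec.const 6)
      (Primrec₂.natPair.comp ha he)) (Primrec.const [])
  have hform : Primrec fun p : ℕ × ℕ => [atIsForm p.1] :=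
    Primrec.list_cons.comp (Primrec₂.natPair.comp (Primrec.const 5)
      (Primrec₂.natPair.comp (Primrec.const _) (Primrec₂.natPair.comp hk hk))) (Primrec.const [])
  refine Primrec.ite (Primrec.eq.comp h₁ (Primrec.const 0)) (hg.comp h₂)
    (Primrec.ite (Primrec.eq.comp h₁ (Primrec.const 1))
      (Primrec.pair (hsat hk (Primrec.const 0)) (Primrec.const []))
      (Primrec.ite (Primrec.eq.comp (Primrec.option_isSome.comp hev) (Primrec.const true))
        (Primrec.pair hform (hsat h₃ h₄)) (Primrec.const _)))

theorem forall_holds_theoryClause {g : ℕ → Clause} {q : Nat.Partrec.Code} {v : ℕ → Prop}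
    (hg : (∀ i, Clause.Holds v (g i)) ↔ Closed v) {k : ℕ} :
    (∀ i, Clause.Holds v (theoryClause g q k i)) ↔
      Closed v ∧ ¬ v (atSat k 0) ∧ ∀ t, (q.eval t).Dom → v (atIsForm k) → ∀ e, v (atSat t e) := by
  rw [← hg]
  constructor
  · refine fun h => ⟨fun i => ?_, ?_, fun t ht hk e => ?_⟩
    · simpa [theoryClause] using h (Nat.pair 0 i)
    · simpa [theoryClause, Clause.Holds, Clause.impl, Clause.disj] using h (Nat.pair 1 0)
    · obtain ⟨x, hx⟩ := Part.dom_iff_mem.1 ht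
      obtain ⟨n, hn⟩ := Nat.Partrec.Code.evaln_complete.1 hx
      have hn' := Nat.Partrec.Code.evaln_mono (Nat.le_add_right n 2) hn
      have hs : (q.evaln (n + 2) t).isSome := Option.isSome_iff_exists.2 ⟨x, hn'⟩
      have := h (Nat.pair (n + 2) (Nat.pair t e))
      simp only [theoryClause, Nat.unpair_pair, hs] at this
      exact this hk
  · rintro ⟨h₁, h₂, h₃⟩ i
    unfold theoryClause
    split_ifs with h h' h''
    · exact h₁ _
    · exact h₂
    · obtain ⟨x, hx⟩ := Option.isSome_iff_exists.1 h''
      exact fun hk =>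
        h₃ _ (Part.dom_iff_mem.2 ⟨x, Nat.Partrec.Code.evaln_complete.2 ⟨_, hx⟩⟩) hk _
    · exact id

end Henkin

theorem LTerm.gnum_injective : Function.Injective LTerm.gnum := by
  intro t
  induction t with
  | var n => intro u h; cases u <;> simp_all [LTerm.gnum]
  | zero => intro u h; cases u <;> simp_all [LTerm.gnum]
  | succ t ih => intro u h; cases u <;> simp [LTerm.gnum] at h; rw [ih h]
  | add t t' ih ih' => intro u h; cases u <;> simp [LTerm.gnum] at h; rw [ih h.1, ih' h.2]
  | mul t t' ih ih' => intro u h; cases u <;> simp [LTerm.gnum] at h; rw [ih h.1, ih' h.2]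

theorem LFormula.gnum_injective : Function.Injective LFormula.gnum := by
  intro t
  induction t with
  | eq t t' =>
    intro u h; cases u <;> simp [LFormula.gnum] at h
    rw [LTerm.gnum_injective h.1, LTerm.gnum_injective h.2]
  | falsum => intro u h; cases u <;> simp_all [LFormula.gnum]
  | imp a b ih ih' => intro u h; cases u <;> simp [LFormula.gnum] at h; rw [ih h.1, ih' h.2]
  | all x a ih => intro u h; cases u <;> simp [LFormula.gnum] at h; rw [h.1, ih h.2]
  | K a ih => intro u h; cases u <;> simp [LFormula.gnum] at h; rw [ih h]

namespace Henkin

/-! ### Correspondence of formulas along a relation between their free variables -/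

/-- The relation between variables induced by `R` under binders for `x` and `y`. -/
def bindRel (x y : ℕ) (R : ℕ → ℕ → Prop) : ℕ → ℕ → Prop :=
  fun u w => (u = x ∧ w = y) ∨ (u ≠ x ∧ w ≠ y ∧ R u w)

/-- Terms that are equal up to replacing variables by related ones. -/
inductive RelT (R : ℕ → ℕ → Prop) : LTerm → LTerm → Prop
  | var {x y : ℕ} : R x y → RelT R (.var x) (.var y)
  | zero : RelT R .zero .zero
  | succ {t u : LTerm} : RelT R t u → RelT R (.succ t) (.succ u)
  | add {t u t' u' : LTerm} : RelT R t t' → RelT R u u' → RelT R (.add t u) (.add t' u')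
  | mul {t u t' u' : LTerm} : RelT R t t' → RelT R u u' → RelT R (.mul t u) (.mul t' u')

/-- Formulas that are equal up to replacing free variables by related ones and, unless `same`
holds, renaming bound variables. -/
inductive RelF (same : Prop) : (ℕ → ℕ → Prop) → LFormula → LFormula → Prop
  | eq {R : ℕ → ℕ → Prop} {t u t' u' : LTerm} :
      RelT R t t' → RelT R u u' → RelF same R (.eq t u) (.eq t' u')
  | falsum {R : ℕ → ℕ → Prop} : RelF same R .falsum .falsum
  | imp {R : ℕ → ℕ → Prop} {a b a' b' : LFormula} :
      RelF same R a a' → RelF same R b b' → RelF same R (.imp a b) (.imp a' b')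
  | all {R : ℕ → ℕ → Prop} {x y : ℕ} {a b : LFormula} :
      (same → x = y) → RelF same (bindRel x y R) a b → RelF same R (.all x a) (.all y b)
  | K {R : ℕ → ℕ → Prop} {a b : LFormula} : RelF same R a b → RelF same R (.K a) (.K b)

theorem relT_of_termAlpha {g : List (ℕ × ℕ)} {t : LTerm} :
    ∀ {u : LTerm}, TermAlpha g t u → RelT (VarCorr g) t u := by
  induction t with
  | var x => intro u h; cases u <;> simp only [TermAlpha] at h; exact .var h
  | zero => intro u h; cases u <;> simp only [TermAlpha] at h; exact .zero
  | succ t ih => intro u h; cases u <;> simp only [TermAlpha] at h; exact .succ (ih h)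
  | add t t' ih ih' =>
    intro u h; cases u <;> simp only [TermAlpha] at h; exact .add (ih h.1) (ih' h.2)
  | mul t t' ih ih' =>
    intro u h; cases u <;> simp only [TermAlpha] at h; exact .mul (ih h.1) (ih' h.2)

theorem RelT.termAlpha {g : List (ℕ × ℕ)} {t u : LTerm} (h : RelT (VarCorr g) t u) :
    TermAlpha g t u := by
  induction h with
  | var h => exact h
  | zero => trivial
  | succ _ ih => exact ih
  | add _ _ ih ih' => exact ⟨ih, ih'⟩
  | mul _ _ ih ih' => exact ⟨ih, ih'⟩

theorem relF_of_formulaAlpha {φ : LFormula} : ∀ {g : List (ℕ × ℕ)} {ψ : LFormula},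
    FormulaAlpha g φ ψ → RelF False (VarCorr g) φ ψ := by
  induction φ with
  | eq t u =>
    intro g ψ h; cases ψ <;> simp only [FormulaAlpha] at h
    exact .eq (relT_of_termAlpha h.1) (relT_of_termAlpha h.2)
  | falsum => intro g ψ h; cases ψ <;> simp only [FormulaAlpha] at h; exact .falsum
  | imp a b ih ih' =>
    intro g ψ h; cases ψ <;> simp only [FormulaAlpha] at h
    exact .imp (ih h.1) (ih' h.2)
  | all x a ih =>
    intro g ψ h; cases ψ <;> simp only [FormulaAlpha] at h
    exact .all False.elim (ih h)
  | K a ih => intro g ψ h; cases ψ <;> simp only [FormulaAlpha] at h; exact .K (ih h)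

theorem RelF.formulaAlpha {R : ℕ → ℕ → Prop} {φ ψ : LFormula} (h : RelF False R φ ψ) :
    ∀ {g : List (ℕ × ℕ)}, R = VarCorr g → FormulaAlpha g φ ψ := by
  induction h with
  | eq h h' => rintro g rfl; simp only [FormulaAlpha]; exact ⟨h.termAlpha, h'.termAlpha⟩
  | falsum => intro g _; simp only [FormulaAlpha]
  | imp _ _ ih ih' => intro g h; simp only [FormulaAlpha]; exact ⟨ih h, ih' h⟩
  | all _ _ ih => rintro g rfl; simp only [FormulaAlpha]; exact ih rfl
  | K _ ih => intro g h; simp only [FormulaAlpha]; exact ih h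

/-- The identity relation restricted to the variables satisfying `P`. -/
def diagRel (P : ℕ → Prop) : ℕ → ℕ → Prop := fun u w => u = w ∧ P u

/-- The relation between variables given by substituting `y` for `x`. -/
def substRel (x y : ℕ) : ℕ → ℕ → Prop := fun u w => (u = x ∧ w = y) ∨ (u ≠ x ∧ u = w)

theorem bindRel_diagRel (x : ℕ) (P : ℕ → Prop) :
    bindRel x x (diagRel P) = diagRel fun u => u = x ∨ P u := by
  funext u w
  simp only [bindRel, diagRel, eq_iff_iff]
  grind

theorem bindRel_substRel_self (x y : ℕ) :
    bindRel x x (substRel x y) = diagRel fun _ => True := by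
  funext u w
  simp only [bindRel, diagRel, substRel, eq_iff_iff]
  grind

theorem bindRel_substRel_target {x y : ℕ} (h : y ≠ x) :
    bindRel y y (substRel x y) = diagRel fun u => u ≠ x := by
  funext u w
  simp only [bindRel, diagRel, substRel, eq_iff_iff]
  grind

theorem bindRel_substRel_of_ne {x y z : ℕ} (hx : z ≠ x) (hy : z ≠ y) :
    bindRel z z (substRel x y) = substRel x y := by
  funext u w
  simp only [bindRel, substRel, eq_iff_iff]
  grind

theorem RelT.diag {P : ℕ → Prop} {t u : LTerm} (h : RelT (diagRel P) t u) :
    t = u ∧ ∀ x ∈ t.fv, P x := by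
  induction h with
  | var h => simp only [LTerm.fv]; cases h.1; simpa using h.2
  | zero => simp [LTerm.fv]
  | succ _ ih => simpa [LTerm.fv] using ih
  | add _ _ ih ih' | mul _ _ ih ih' =>
    simp only [LTerm.fv, Finset.mem_union]; grind

theorem relT_diagRel {P : ℕ → Prop} {t : LTerm} (h : ∀ x ∈ t.fv, P x) :
    RelT (diagRel P) t t := by
  induction t with
  | var x => exact .var ⟨rfl, h x (by simp [LTerm.fv])⟩
  | zero => exact .zero
  | succ t ih => exact .succ (ih h)
  | add t u ih ih' =>
    simp only [LTerm.fv, Finset.mem_union] at h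
    exact .add (ih fun x hx => h x (.inl hx)) (ih' fun x hx => h x (.inr hx))
  | mul t u ih ih' =>
    simp only [LTerm.fv, Finset.mem_union] at h
    exact .mul (ih fun x hx => h x (.inl hx)) (ih' fun x hx => h x (.inr hx))

theorem RelF.diag {same : Prop} (hs : same) {R : ℕ → ℕ → Prop} {φ ψ : LFormula}
    (h : RelF same R φ ψ) :
    ∀ {P : ℕ → Prop}, R = diagRel P → φ = ψ ∧ ∀ x ∈ φ.fv, P x := by
  induction h with
  | eq h h' =>
    rintro P rfl
    have := h.diag
    have := h'.diag
    simp only [LFormula.fv, Finset.mem_union]; grind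
  | falsum => simp [LFormula.fv]
  | imp _ _ ih ih' =>
    intro P hP
    have := ih hP
    have := ih' hP
    simp only [LFormula.fv, Finset.mem_union]; grind
  | all hxy _ ih =>
    rintro P rfl
    cases hxy hs
    have := ih (bindRel_diagRel _ P)
    simp only [LFormula.fv, Finset.mem_erase]; grind
  | K _ ih =>
    intro P hP
    have := ih hP
    simp only [LFormula.fv]; grind

theorem relF_diagRel {same : Prop} {φ : LFormula} : ∀ {P : ℕ → Prop}, (∀ x ∈ φ.fv, P x) →
    RelF same (diagRel P) φ φ := by
  induction φ with
  | eq t u =>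
    intro P h
    simp only [LFormula.fv, Finset.mem_union] at h
    exact .eq (relT_diagRel fun x hx => h x (.inl hx)) (relT_diagRel fun x hx => h x (.inr hx))
  | falsum => exact fun _ => .falsum
  | imp a b ih ih' =>
    intro P h
    simp only [LFormula.fv, Finset.mem_union] at h
    exact .imp (ih fun x hx => h x (.inl hx)) (ih' fun x hx => h x (.inr hx))
  | all x a ih =>
    intro P h
    simp only [LFormula.fv, Finset.mem_erase] at h
    refine .all (fun _ => rfl) (bindRel_diagRel x P ▸ ih fun y hy => ?_)
    exact or_iff_not_imp_left.2 fun hne => h y ⟨hne, hy⟩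
  | K a ih => exact fun h => .K (ih h)

theorem termSubst_eq_self {s : ℕ → LTerm} {t : LTerm} (h : ∀ x ∈ t.fv, s x = .var x) :
    t.subst s = t := by
  induction t with
  | var x => exact h x (by simp [LTerm.fv])
  | zero => rfl
  | succ t ih => rw [LTerm.subst, ih h]
  | add t u ih ih' | mul t u ih ih' =>
    simp only [LTerm.fv, Finset.mem_union] at h
    rw [LTerm.subst, ih fun x hx => h x (.inl hx), ih' fun x hx => h x (.inr hx)]

theorem subst_eq_self {φ : LFormula} : ∀ {s : ℕ → LTerm}, (∀ x ∈ φ.fv, s x = .var x) →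
    φ.subst s = φ := by
  induction φ with
  | eq t u =>
    intro s h
    simp only [LFormula.fv, Finset.mem_union] at h
    rw [LFormula.subst, termSubst_eq_self fun x hx => h x (.inl hx),
      termSubst_eq_self fun x hx => h x (.inr hx)]
  | falsum => exact fun _ => rfl
  | imp a b ih ih' =>
    intro s h
    simp only [LFormula.fv, Finset.mem_union] at h
    rw [LFormula.subst, ih fun x hx => h x (.inl hx), ih' fun x hx => h x (.inr hx)]
  | all x a ih =>
    intro s h
    simp only [LFormula.fv, Finset.mem_erase] at h
    rw [LFormula.subst, ih]
    intro y hy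
    split_ifs with hyx
    · rw [hyx]
    · exact h y ⟨hyx, hy⟩
  | K a ih => intro s h; rw [LFormula.subst, ih h]

theorem subst1_all_self (x : ℕ) (t : LTerm) (φ : LFormula) :
    subst1 x t (.all x φ) = .all x φ :=
  subst_eq_self fun y hy => if_neg (by simp only [LFormula.fv, Finset.mem_erase] at hy; exact hy.1)

theorem subst1_eq_self {x : ℕ} {t : LTerm} {φ : LFormula} (h : x ∉ φ.fv) : subst1 x t φ = φ :=
  subst_eq_self fun y hy => if_neg (by rintro rfl; exact h hy)

theorem subst1_all_of_ne {x z : ℕ} (h : z ≠ x) (t : LTerm) (φ : LFormula) :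
    subst1 x t (.all z φ) = .all z (subst1 x t φ) := by
  simp only [subst1, LFormula.subst]
  congr 2
  funext y
  grind

theorem substitutableVar_of_notMem {x y : ℕ} {φ : LFormula} :
    x ∉ φ.fv → SubstitutableVar y x φ := by
  induction φ with
  | eq t u => exact fun _ => trivial
  | falsum => exact fun _ => trivial
  | imp a b ih ih' =>
    intro h
    simp only [LFormula.fv, Finset.mem_union, not_or] at h
    exact ⟨ih h.1, ih' h.2⟩
  | all z a ih => exact fun h => .inl h
  | K a ih => exact fun h => ih h

theorem RelT.eq_subst {x y : ℕ} {t u : LTerm} (h : RelT (substRel x y) t u) :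
    u = t.subst fun z => if z = x then .var y else .var z := by
  induction h with
  | var h => simp only [LTerm.subst]; simp only [substRel] at h; grind
  | zero => rfl
  | succ _ ih => simp only [LTerm.subst, ← ih]
  | add _ _ ih ih' | mul _ _ ih ih' => simp only [LTerm.subst, ← ih, ← ih']

theorem relT_substRel (x y : ℕ) (t : LTerm) :
    RelT (substRel x y) t (t.subst fun z => if z = x then .var y else .var z) := by
  induction t with
  | var z =>
    simp only [LTerm.subst]
    split_ifs with h
    · exact .var (.inl ⟨h, rfl⟩)
    · exact .var (.inr ⟨h, rfl⟩)
  | zero => exact .zero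
  | succ t ih => exact .succ ih
  | add t u ih ih' => exact .add ih ih'
  | mul t u ih ih' => exact .mul ih ih'

theorem RelF.subst {same : Prop} (hs : same) {x y : ℕ} {R : ℕ → ℕ → Prop} {φ ψ : LFormula}
    (h : RelF same R φ ψ) :
    R = substRel x y → SubstitutableVar y x φ ∧ ψ = subst1 x (.var y) φ := by
  induction h with
  | eq h h' =>
    rintro rfl
    exact ⟨trivial, congrArg₂ _ h.eq_subst h'.eq_subst⟩
  | falsum => exact fun _ => ⟨trivial, rfl⟩
  | imp _ _ ih ih' =>
    exact fun hR => ⟨⟨(ih hR).1, (ih' hR).1⟩, congrArg₂ _ (ih hR).2 (ih' hR).2⟩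
  | @all R z z' a b hzz h ih =>
    rintro rfl
    cases hzz hs
    by_cases hx : z = x
    · subst hx
      obtain ⟨rfl, -⟩ := h.diag hs (bindRel_substRel_self _ _)
      exact ⟨.inl (by simp [LFormula.fv]), (subst1_all_self _ _ _).symm⟩
    rw [subst1_all_of_ne hx]
    by_cases hy : z = y
    · subst hy
      obtain ⟨rfl, hf⟩ := h.diag hs (bindRel_substRel_target hx)
      have hf : x ∉ a.fv := fun hm => hf x hm rfl
      exact ⟨.inl (by simp [LFormula.fv, hf]), by rw [subst1_eq_self hf]⟩
    · obtain ⟨h₁, h₂⟩ := ih (bindRel_substRel_of_ne hx hy)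
      exact ⟨.inr ⟨Ne.symm hy, h₁⟩, by rw [h₂]⟩
  | K _ ih => exact fun hR => ⟨(ih hR).1, congrArg _ (ih hR).2⟩

theorem relF_substRel {same : Prop} {x y : ℕ} {φ : LFormula} : SubstitutableVar y x φ →
    RelF same (substRel x y) φ (subst1 x (.var y) φ) := by
  induction φ with
  | eq t u => exact fun _ => .eq (relT_substRel _ _ _) (relT_substRel _ _ _)
  | falsum => exact fun _ => .falsum
  | imp a b ih ih' => exact fun h => .imp (ih h.1) (ih' h.2)
  | all z a ih =>
    intro h
    by_cases hx : z = x
    · subst hx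
      rw [subst1_all_self]
      exact .all (fun _ => rfl) (bindRel_substRel_self z y ▸ relF_diagRel fun _ _ => trivial)
    rw [subst1_all_of_ne hx]
    refine .all (fun _ => rfl) ?_
    by_cases hy : z = y
    · subst hy
      have hf : x ∉ a.fv := by
        rcases h with h | h
        · simpa [LFormula.fv, Ne.symm hx] using h
        · exact absurd rfl h.1
      rw [bindRel_substRel_target hx, subst1_eq_self hf]
      exact relF_diagRel fun u hu => by rintro rfl; exact hf hu
    · rw [bindRel_substRel_of_ne hx hy]
      refine ih ?_
      rcases h with h | h
      · exact substitutableVar_of_notMem (by simpa [LFormula.fv, Ne.symm hx] using h)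
      · exact h.2
  | K a ih => exact fun h => .K (ih h)

end Henkin

namespace Henkin

/-! ### Valuations given by 𝓛-structures -/

theorem lt_natPair {t d r : ℕ} (ht : 0 < t) (h : d ≤ r) : d < Nat.pair t r := by
  have := Nat.add_le_pair t r
  omega

section Interpretation

variable (M : LStructure) (s : ℕ → M.U)

open Classical in
/-- The meanings in `M` of all codes, as names of elements and as environments, where `s` is the
initial environment. -/
noncomputable def interp (n : ℕ) : M.U × (ℕ → M.U) :=
  let rec' (m : ℕ) : M.U × (ℕ → M.U) := if m < n then interp m else (s 0, s)
  haveI := M.nonempty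
  (match n.unpair.1 with
    | 0 => M.zero
    | 1 => M.succ (rec' n.unpair.2).1
    | 2 => M.add (rec' n.unpair.2.unpair.1).1 (rec' n.unpair.2.unpair.2).1
    | 3 => M.mul (rec' n.unpair.2.unpair.1).1 (rec' n.unpair.2.unpair.2).1
    | 4 => Classical.epsilon fun u => ∀ φ : LFormula, φ.gnum = n.unpair.2.unpair.2.unpair.1 →
        ¬ M.Sat (Function.update (rec' n.unpair.2.unpair.2.unpair.2).2 n.unpair.2.unpair.1 u) φ
    | _ => s n.unpair.2,
  match n with
    | 0 => s
    | m + 1 => Function.update (rec' m.unpair.2).2 m.unpair.1.unpair.1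
        (rec' m.unpair.1.unpair.2).1)
termination_by n

/-- The element of `M` named by a code. -/
noncomputable def elt (n : ℕ) : M.U := (interp M s n).1

/-- The assignment in `M` coded by an environment. -/
noncomputable def env (n : ℕ) : ℕ → M.U := (interp M s n).2

theorem elt_zero : elt M s nmZero = M.zero := by
  rw [elt, interp.eq_def]
  simp

theorem elt_succ (d : ℕ) : elt M s (nmSucc d) = M.succ (elt M s d) := by
  rw [elt, interp.eq_def]
  simp only [Nat.unpair_pair, if_pos (lt_natPair one_pos le_rfl), elt]

theorem elt_add (d e : ℕ) : elt M s (nmAdd d e) = M.add (elt M s d) (elt M s e) := by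
  rw [elt, interp.eq_def]
  simp only [Nat.unpair_pair, if_pos (lt_natPair two_pos (Nat.left_le_pair d e)),
    if_pos (lt_natPair two_pos (Nat.right_le_pair d e)), elt]

theorem elt_mul (d e : ℕ) : elt M s (nmMul d e) = M.mul (elt M s d) (elt M s e) := by
  rw [elt, interp.eq_def]
  simp only [Nat.unpair_pair, if_pos (lt_natPair three_pos (Nat.left_le_pair d e)),
    if_pos (lt_natPair three_pos (Nat.right_le_pair d e)), elt]

theorem elt_var (x : ℕ) : elt M s (nmVar x) = s x := by
  rw [elt, interp.eq_def]
  simp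

theorem env_zero : env M s 0 = s := by
  rw [env, interp.eq_def]

theorem env_extend (x d e : ℕ) :
    env M s (extend x d e) = Function.update (env M s e) x (elt M s d) := by
  have h₁ : d < extend x d e :=
    Nat.lt_succ_of_le ((Nat.right_le_pair x d).trans (Nat.left_le_pair _ _))
  have h₂ : e < extend x d e := Nat.lt_succ_of_le (Nat.right_le_pair _ _)
  rw [env, interp.eq_def]
  simp only [Nat.unpair_pair, if_pos h₁, if_pos h₂, elt, env]

theorem sat_of_sat_elt_wit {x e : ℕ} {φ : LFormula}
    (h : M.Sat (Function.update (env M s e) x (elt M s (nmWit x φ.gnum e))) φ) (u : M.U) :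
    M.Sat (Function.update (env M s e) x u) φ := by
  have he : e < nmWit x φ.gnum e := lt_natPair four_pos
    ((Nat.right_le_pair φ.gnum e).trans (Nat.right_le_pair _ _))
  by_contra hu
  have := M.nonempty
  have key := Classical.epsilon_spec (p := fun u => ∀ ψ : LFormula, ψ.gnum = φ.gnum →
    ¬ M.Sat (Function.update (env M s e) x u) ψ)
    ⟨u, fun ψ hψ => LFormula.gnum_injective hψ ▸ hu⟩ φ rfl
  rw [elt, interp.eq_def] at h
  simp only [Nat.unpair_pair, if_pos he] at h
  exact key h

/-- The relation between variables coded by a list of pairs, given the one between free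
variables. -/
def codeRel (R : ℕ → ℕ → Prop) : ℕ → ℕ → ℕ → Prop
  | 0 => R
  | n + 1 => bindRel n.unpair.1.unpair.1 n.unpair.1.unpair.2 (codeRel R n.unpair.2)
decreasing_by exact Nat.lt_succ_of_le (Nat.unpair_right_le n)

theorem codeRel_zero (R : ℕ → ℕ → Prop) : codeRel R 0 = R := by
  rw [codeRel]

theorem codeRel_extend (R : ℕ → ℕ → Prop) (x y g : ℕ) :
    codeRel R (extend x y g) = bindRel x y (codeRel R g) := by
  rw [codeRel]
  simp only [Nat.unpair_pair]

/-- The coded relations between free variables. -/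
def baseRel (r : ℕ) : ℕ → ℕ → Prop :=
  match r.unpair.1 with
  | 0 => Eq
  | 1 => substRel r.unpair.2.unpair.1 r.unpair.2.unpair.2
  | _ => diagRel fun x => env M s r.unpair.2.unpair.1 x = env M s r.unpair.2.unpair.2 x

theorem baseRel_id : baseRel M s relId = Eq := by
  simp [baseRel]

theorem baseRel_sub (x y : ℕ) : baseRel M s (relSub x y) = substRel x y := by
  simp [baseRel]

theorem baseRel_agree (e e' : ℕ) :
    baseRel M s (relAgree e e') = diagRel fun x => env M s e x = env M s e' x := by
  simp [baseRel]

/-- The truth values of all atoms in `M`, where `s` is the initial environment. -/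
def val (n : ℕ) : Prop :=
  let p := n.unpair.2
  match n.unpair.1 with
  | 0 => elt M s p.unpair.1 = elt M s p.unpair.2
  | 1 => p.unpair.1 ≠ p.unpair.2
  | 2 => ∃ t : LTerm, t.gnum = p.unpair.1 ∧
      M.evalT (env M s p.unpair.2.unpair.1) t = elt M s p.unpair.2.unpair.2
  | 3 => codeRel (baseRel M s p.unpair.1.unpair.1) p.unpair.1.unpair.2 p.unpair.2.unpair.1
      p.unpair.2.unpair.2
  | 4 => ∃ t u : LTerm, t.gnum = p.unpair.2.unpair.1 ∧ u.gnum = p.unpair.2.unpair.2 ∧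
      RelT (codeRel (baseRel M s p.unpair.1.unpair.1) p.unpair.1.unpair.2) t u
  | 5 => ∃ φ ψ : LFormula, φ.gnum = p.unpair.2.unpair.1 ∧ ψ.gnum = p.unpair.2.unpair.2 ∧
      RelF (p.unpair.1.unpair.1 ≠ relId)
        (codeRel (baseRel M s p.unpair.1.unpair.1) p.unpair.1.unpair.2) φ ψ
  | _ => ∃ φ : LFormula, φ.gnum = p.unpair.1 ∧ M.Sat (env M s p.unpair.2) φ

theorem val_eq {d e : ℕ} : val M s (atEq d e) ↔ elt M s d = elt M s e := by
  simp [val]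

theorem val_ne {x y : ℕ} : val M s (atNe x y) ↔ x ≠ y := by
  simp [val]

theorem val_val {t e d : ℕ} : val M s (atVal t e d) ↔
    ∃ t' : LTerm, t'.gnum = t ∧ M.evalT (env M s e) t' = elt M s d := by
  simp [val]

theorem val_var {r g x y : ℕ} :
    val M s (atVar r g x y) ↔ codeRel (baseRel M s r) g x y := by
  simp [val]

theorem val_term {r g t u : ℕ} : val M s (atTerm r g t u) ↔
    ∃ t' u' : LTerm, t'.gnum = t ∧ u'.gnum = u ∧ RelT (codeRel (baseRel M s r) g) t' u' := by
  simp [val]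

theorem val_form {r g a b : ℕ} : val M s (atForm r g a b) ↔
    ∃ φ ψ : LFormula, φ.gnum = a ∧ ψ.gnum = b ∧
      RelF (r ≠ relId) (codeRel (baseRel M s r) g) φ ψ := by
  simp [val]

theorem val_sat {a e : ℕ} : val M s (atSat a e) ↔
    ∃ φ : LFormula, φ.gnum = a ∧ M.Sat (env M s e) φ := by
  simp [val]

theorem val_sat_gnum {φ : LFormula} {e : ℕ} :
    val M s (atSat φ.gnum e) ↔ M.Sat (env M s e) φ := by
  rw [val_sat]
  exact ⟨fun ⟨ψ, h, h'⟩ => LFormula.gnum_injective h ▸ h', fun h => ⟨φ, rfl, h⟩⟩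

theorem val_val_gnum {t : LTerm} {e d : ℕ} :
    val M s (atVal t.gnum e d) ↔ M.evalT (env M s e) t = elt M s d := by
  rw [val_val]
  exact ⟨fun ⟨ψ, h, h'⟩ => LTerm.gnum_injective h ▸ h', fun h => ⟨t, rfl, h⟩⟩

theorem val_val_var {x e d : ℕ} : val M s (atVal (tmVar x) e d) ↔ env M s e x = elt M s d :=
  val_val_gnum M s (t := .var x)

end Interpretation

set_option maxHeartbeats 1000000 in
/-- The valuation given by an 𝓛-structure satisfies all clause schemes. -/
theorem closed_val {M : LStructure} (hM : IsLStructure M) (s : ℕ → M.U) : Closed (val M s) := by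
  obtain ⟨hfv, halpha, hsub⟩ := hM
  have hid : (Eq : ℕ → ℕ → Prop) = VarCorr [] := by
    funext x y
    simp [VarCorr]
  have hne : (relId ≠ relId) = False := by simp
  intro r a b c d e f
  cases r <;> simp only [clause, Clause.Holds, Clause.impl, Clause.disj, val_eq, val_ne, val_var,
    val_val_var]
  case neZeroSucc => omega
  case neSuccZero => omega
  case neSuccSucc => omega
  case eqSymm => exact Eq.symm
  case eqTrans => exact Eq.trans
  case eqSucc => intro h; rw [elt_succ, elt_succ, h]
  case eqAdd => intro h h'; rw [elt_add, elt_add, h, h']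
  case eqMul => intro h h'; rw [elt_mul, elt_mul, h, h']
  case valInit => rw [env_zero, elt_var]
  case valHere => rw [env_extend, Function.update_self]
  case valThere => intro h h'; rw [env_extend, Function.update_of_ne h, h']
  case valZero => exact (val_val_gnum M s (t := .zero)).2 (elt_zero M s).symm
  case valSucc =>
    rw [val_val]
    rintro ⟨t, rfl, h⟩
    exact (val_val_gnum M s (t := .succ t)).2 (by rw [elt_succ, ← h]; rfl)
  case valAdd =>
    rw [val_val, val_val]
    rintro ⟨t, rfl, h⟩ ⟨u, rfl, h'⟩
    exact (val_val_gnum M s (t := .add t u)).2 (by rw [elt_add, ← h, ← h']; rfl)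
  case valMul =>
    rw [val_val, val_val]
    rintro ⟨t, rfl, h⟩ ⟨u, rfl, h'⟩
    exact (val_val_gnum M s (t := .mul t u)).2 (by rw [elt_mul, ← h, ← h']; rfl)
  case varHere => rw [codeRel_extend]; exact .inl ⟨rfl, rfl⟩
  case varThere => rw [codeRel_extend]; exact fun h h' hR => .inr ⟨h, h', hR⟩
  case varId => rw [codeRel_zero, baseRel_id]
  case varSub => rw [codeRel_zero, baseRel_sub]; exact .inl ⟨rfl, rfl⟩
  case varSubNe => rw [codeRel_zero, baseRel_sub]; exact fun h => .inr ⟨h, rfl⟩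
  case varAgree =>
    rw [codeRel_zero, baseRel_agree]
    exact fun h h' hd => ⟨rfl, h.trans (hd.trans h'.symm)⟩
  case termVar => exact fun h => (val_term M s).2 ⟨.var c, .var d, rfl, rfl, .var h⟩
  case termZero => exact (val_term M s).2 ⟨.zero, .zero, rfl, rfl, .zero⟩
  case termSucc =>
    rw [val_term, val_term]
    rintro ⟨t, u, rfl, rfl, h⟩
    exact ⟨_, _, rfl, rfl, .succ h⟩
  case termAdd =>
    rw [val_term, val_term, val_term]
    rintro ⟨t, u, rfl, rfl, h⟩ ⟨t', u', rfl, rfl, h'⟩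
    exact ⟨_, _, rfl, rfl, .add h h'⟩
  case termMul =>
    rw [val_term, val_term, val_term]
    rintro ⟨t, u, rfl, rfl, h⟩ ⟨t', u', rfl, rfl, h'⟩
    exact ⟨_, _, rfl, rfl, .mul h h'⟩
  case formEq =>
    rw [val_term, val_term, val_form]
    rintro ⟨t, u, rfl, rfl, h⟩ ⟨t', u', rfl, rfl, h'⟩
    exact ⟨_, _, rfl, rfl, .eq h h'⟩
  case formFalsum => exact (val_form M s).2 ⟨.falsum, .falsum, rfl, rfl, .falsum⟩
  case formImp =>
    rw [val_form, val_form, val_form]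
    rintro ⟨t, u, rfl, rfl, h⟩ ⟨t', u', rfl, rfl, h'⟩
    exact ⟨_, _, rfl, rfl, .imp h h'⟩
  case formAll =>
    rw [val_form, val_form, codeRel_extend]
    rintro ⟨t, u, rfl, rfl, h⟩
    exact ⟨_, _, rfl, rfl, .all (fun _ => rfl) h⟩
  case formAllId =>
    rw [val_form, val_form, codeRel_extend]
    rintro ⟨t, u, rfl, rfl, h⟩
    exact ⟨_, _, rfl, rfl, .all (fun h => absurd rfl h) h⟩
  case formK =>
    rw [val_form, val_form]
    rintro ⟨t, u, rfl, rfl, h⟩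
    exact ⟨_, _, rfl, rfl, .K h⟩
  case satEq =>
    rw [val_val, val_val]
    rintro ⟨t, rfl, h⟩ ⟨u, rfl, h'⟩ hs
    exact h.symm.trans (((val_sat_gnum M s (φ := .eq t u)).1 hs).trans h')
  case eqSat =>
    rw [val_val, val_val]
    rintro ⟨t, rfl, h⟩ ⟨u, rfl, h'⟩ hs
    exact (val_sat_gnum M s (φ := .eq t u)).2 (h.trans (hs.trans h'.symm))
  case satFalsum => exact (val_sat_gnum M s (φ := .falsum)).1
  case impElim =>
    rw [val_sat, val_sat, val_sat]
    rintro ⟨χ, hχ, h⟩ ⟨φ, rfl, h'⟩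
    cases χ <;> simp [LFormula.gnum] at hχ
    cases LFormula.gnum_injective hχ.1
    exact ⟨_, hχ.2, h h'⟩
  case impIntro =>
    rw [val_form, val_sat]
    rintro ⟨φ, -, rfl, -, -⟩ ⟨ψ, rfl, h⟩
    exact (val_sat_gnum M s (φ := .imp φ ψ)).2 fun _ => h
  case impCases =>
    rw [val_form, val_form]
    rintro ⟨φ, -, rfl, -, -⟩ ⟨ψ, -, rfl, -, -⟩
    rw [val_sat_gnum]
    refine (em _).symm.imp_left fun h => (val_sat_gnum M s (φ := .imp φ ψ)).2 fun h' => absurd h' h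
  case allElim =>
    rw [val_sat, val_sat, env_extend]
    rintro ⟨χ, hχ, h⟩
    cases χ <;> simp [LFormula.gnum] at hχ
    exact ⟨_, hχ.2, by rw [← hχ.1]; exact h _⟩
  case allIntro =>
    rw [val_sat, env_extend]
    rintro ⟨φ, rfl, h⟩
    exact (val_sat_gnum M s (φ := .all a φ)).2 fun u => sat_of_sat_elt_wit M s h u
  case satAgree =>
    rw [val_form, codeRel_zero, baseRel_agree]
    rintro ⟨φ, ψ, rfl, hψ, h⟩ h'
    have hne : relAgree b c ≠ relId := fun h => by
      simpa using congrArg (fun n => n.unpair.1) h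
    exact (val_sat_gnum M s (φ := .K φ)).2
      ((hfv φ _ _ (h.diag hne rfl).2).1 ((val_sat_gnum M s (φ := .K φ)).1 h'))
  case satAlpha =>
    rw [val_form, codeRel_zero, baseRel_id, hne, hid]
    rintro ⟨φ, ψ, rfl, rfl, h⟩ h'
    exact (val_sat_gnum M s (φ := .K ψ)).2
      ((halpha φ ψ _ (h.formulaAlpha rfl)).1 ((val_sat_gnum M s (φ := .K φ)).1 h'))
  case alphaSat =>
    rw [val_form, codeRel_zero, baseRel_id, hne, hid]
    rintro ⟨φ, ψ, rfl, rfl, h⟩ h'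
    exact (val_sat_gnum M s (φ := .K φ)).2
      ((halpha φ ψ _ (h.formulaAlpha rfl)).2 ((val_sat_gnum M s (φ := .K ψ)).1 h'))
  case satSub =>
    rw [val_form, codeRel_zero, baseRel_sub]
    rintro ⟨φ, ψ, rfl, rfl, h⟩ hv h'
    have hne : relSub a b ≠ relId := fun h => by
      simpa using congrArg (fun n => n.unpair.1) h
    obtain ⟨h₁, rfl⟩ := h.subst hne rfl
    refine (val_sat_gnum M s (φ := .K φ)).2 ?_
    rw [env_extend, ← hv]
    exact (hsub _ _ _ _ h₁).1 ((val_sat_gnum M s (φ := .K (subst1 _ _ _))).1 h')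
  case subSat =>
    rw [val_form, codeRel_zero, baseRel_sub]
    rintro ⟨φ, ψ, rfl, rfl, h⟩ hv h'
    have hne : relSub a b ≠ relId := fun h => by
      simpa using congrArg (fun n => n.unpair.1) h
    obtain ⟨h₁, rfl⟩ := h.subst hne rfl
    have h' := (val_sat_gnum M s (φ := .K φ)).1 h'
    rw [env_extend, ← hv] at h'
    exact (val_sat_gnum M s (φ := .K (subst1 _ _ _))).2 ((hsub _ _ _ _ h₁).2 h')

end Henkin

namespace Henkin

/-! ### The 𝓛-structure of names -/

theorem extend_induction {p : ℕ → Prop} (zero : p 0)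
    (ext : ∀ x d e, p e → p (extend x d e)) (n : ℕ) : p n := by
  induction n using Nat.strong_induction_on with
  | _ n ih =>
    cases n with
    | zero => exact zero
    | succ n =>
      simpa only [extend, Nat.pair_unpair] using
        ext n.unpair.1.unpair.1 n.unpair.1.unpair.2 n.unpair.2
          (ih _ (Nat.lt_succ_of_le (Nat.unpair_right_le n)))

/-- The name of the value of a variable under a coded environment. -/
def lookup : ℕ → ℕ → ℕ
  | 0 => nmVar
  | n + 1 => Function.update (lookup n.unpair.2) n.unpair.1.unpair.1 n.unpair.1.unpair.2
decreasing_by exact Nat.lt_succ_of_le (Nat.unpair_right_le n)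

theorem lookup_zero : lookup 0 = nmVar := by
  rw [lookup]

theorem lookup_extend (x d e : ℕ) :
    lookup (extend x d e) = Function.update (lookup e) x d := by
  rw [lookup]
  simp only [Nat.unpair_pair]

/-- The name of the value of a term under a coded environment. -/
def termName (σ : ℕ) : LTerm → ℕ
  | .var x => lookup σ x
  | .zero => nmZero
  | .succ t => nmSucc (termName σ t)
  | .add t u => nmAdd (termName σ t) (termName σ u)
  | .mul t u => nmMul (termName σ t) (termName σ u)

namespace Closed

variable {v : ℕ → Prop} (hv : Closed v)

include hv

theorem ne {x y : ℕ} (h : x ≠ y) : v (atNe x y) := by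
  induction x generalizing y with
  | zero =>
    obtain ⟨y, rfl⟩ := Nat.exists_eq_succ_of_ne_zero h.symm
    exact hv .neZeroSucc y 0 0 0 0 0
  | succ x ih =>
    cases y with
    | zero => exact hv .neSuccZero x 0 0 0 0 0
    | succ y => exact hv .neSuccSucc x y 0 0 0 0 (ih (by simpa using h))

theorem val_lookup (e x : ℕ) : v (atVal (tmVar x) e (lookup e x)) := by
  induction e using extend_induction with
  | zero => rw [lookup_zero]; exact hv .valInit x 0 0 0 0 0
  | ext y d e ih =>
    rw [lookup_extend]
    by_cases h : x = y
    · subst h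
      rw [Function.update_self]
      exact hv .valHere x d e 0 0 0
    · rw [Function.update_of_ne h]
      exact hv .valThere x y (lookup e x) d e 0 (hv.ne h) ih

theorem val_termName (e : ℕ) (t : LTerm) : v (atVal t.gnum e (termName e t)) := by
  induction t with
  | var x => exact hv.val_lookup e x
  | zero => exact hv .valZero e 0 0 0 0 0
  | succ t ih => exact hv .valSucc _ _ _ 0 0 0 ih
  | add t u ih ih' => exact hv .valAdd _ _ _ _ _ 0 ih ih'
  | mul t u ih ih' => exact hv .valMul _ _ _ _ _ 0 ih ih'

theorem var_of_codeRel {r : ℕ} {R : ℕ → ℕ → Prop} (hR : ∀ u w, R u w → v (atVar r 0 u w))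
    {g u w : ℕ} (h : codeRel R g u w) : v (atVar r g u w) := by
  induction g using extend_induction with
  | zero => rw [codeRel_zero] at h; exact hR u w h
  | ext x y g ih =>
    rw [codeRel_extend] at h
    rcases h with ⟨rfl, rfl⟩ | ⟨hx, hy, h⟩
    · exact hv .varHere r g u w 0 0
    · exact hv .varThere r g x y u w (hv.ne hx) (hv.ne hy) (ih h)

theorem term_of_relT {r : ℕ} {R : ℕ → ℕ → Prop} (hR : ∀ u w, R u w → v (atVar r 0 u w))
    {g : ℕ} {t u : LTerm} (h : RelT (codeRel R g) t u) : v (atTerm r g t.gnum u.gnum) := by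
  induction h with
  | var h => exact hv .termVar r g _ _ 0 0 (hv.var_of_codeRel hR h)
  | zero => exact hv .termZero r g 0 0 0 0
  | succ _ ih => exact hv .termSucc r g _ _ 0 0 ih
  | add _ _ ih ih' => exact hv .termAdd r g _ _ _ _ ih ih'
  | mul _ _ ih ih' => exact hv .termMul r g _ _ _ _ ih ih'

theorem form_of_relF {r : ℕ} {R R' : ℕ → ℕ → Prop} (hR : ∀ u w, R u w → v (atVar r 0 u w))
    {φ ψ : LFormula} (h : RelF (r ≠ relId) R' φ ψ) :
    ∀ {g : ℕ}, R' = codeRel R g → v (atForm r g φ.gnum ψ.gnum) := by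
  induction h with
  | eq h h' =>
    rintro g rfl
    exact hv .formEq r g _ _ _ _ (hv.term_of_relT hR h) (hv.term_of_relT hR h')
  | falsum => exact fun {g} _ => hv .formFalsum r g 0 0 0 0
  | imp _ _ ih ih' => exact fun {g} hg => hv .formImp r g _ _ _ _ (ih hg) (ih' hg)
  | @all R' x y a b hxy _ ih =>
    rintro g rfl
    have h := ih (codeRel_extend R x y g).symm
    by_cases hr : r = relId
    · subst hr
      exact hv .formAllId g x y _ _ 0 h
    · cases hxy hr
      exact hv .formAll r g x _ _ 0 h
  | K _ ih => exact fun {g} hg => hv .formK r g _ _ 0 0 (ih hg)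

theorem form_agree {e e' : ℕ} {φ : LFormula}
    (h : ∀ x ∈ φ.fv, v (atEq (lookup e x) (lookup e' x))) :
    v (atForm (relAgree e e') 0 φ.gnum φ.gnum) := by
  refine hv.form_of_relF (R := diagRel fun x => v (atEq (lookup e x) (lookup e' x)))
    ?_ (relF_diagRel h) (codeRel_zero _).symm
  rintro x _ ⟨rfl, hx⟩
  exact hv .varAgree e e' x _ _ 0 (hv.val_lookup e x) (hv.val_lookup e' x) hx

theorem isForm (φ : LFormula) : v (atIsForm φ.gnum) :=
  hv.form_agree fun _ _ => hv .eqRefl _ 0 0 0 0 0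

theorem form_alpha {φ ψ : LFormula} (h : AlphaVariant φ ψ) :
    v (atForm relId 0 φ.gnum ψ.gnum) := by
  refine hv.form_of_relF (R := VarCorr []) ?_ ?_ (codeRel_zero _).symm
  · rintro x y h
    cases h
    exact hv .varId x 0 0 0 0 0
  · rw [show (relId ≠ relId) = False by simp]
    exact relF_of_formulaAlpha h

theorem form_subst {x y : ℕ} {φ : LFormula} (h : SubstitutableVar y x φ) :
    v (atForm (relSub x y) 0 φ.gnum (subst1 x (.var y) φ).gnum) := by
  refine hv.form_of_relF (R := substRel x y) ?_ (relF_substRel h) (codeRel_zero _).symm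
  rintro u w (⟨rfl, rfl⟩ | ⟨hu, rfl⟩)
  · exact hv .varSub u w 0 0 0 0
  · exact hv .varSubNe x y u 0 0 0 (hv.ne hu)

/-- Equality of the elements named by codes. -/
@[reducible] def setoid : Setoid ℕ where
  r d e := v (atEq d e)
  iseqv := ⟨fun d => hv .eqRefl d 0 0 0 0 0, fun h => hv .eqSymm _ _ 0 0 0 0 h,
    fun h h' => hv .eqTrans _ _ _ 0 0 0 h h'⟩

/-- The structure of the elements named by codes. -/
def model : LStructure where
  U := Quotient hv.setoid
  nonempty := ⟨Quotient.mk _ 0⟩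
  zero := Quotient.mk _ nmZero
  succ := Quotient.map nmSucc fun _ _ h => hv .eqSucc _ _ 0 0 0 0 h
  add := Quotient.map₂ nmAdd fun _ _ h _ _ h' => hv .eqAdd _ _ _ _ 0 0 h h'
  mul := Quotient.map₂ nmMul fun _ _ h _ _ h' => hv .eqMul _ _ _ _ 0 0 h h'
  satK s φ := ∃ σ, (∀ x ∈ φ.fv, s x = Quotient.mk _ (lookup σ x)) ∧ v (atSat (fmK φ.gnum) σ)

theorem exists_env (s : ℕ → hv.model.U) (S : Finset ℕ) :
    ∃ σ, ∀ x ∈ S, s x = Quotient.mk hv.setoid (lookup σ x) := by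
  induction S using Finset.induction_on with
  | empty => exact ⟨0, by simp⟩
  | insert a S _ ih =>
    obtain ⟨σ, hσ⟩ := ih
    obtain ⟨d, hd⟩ := Quotient.exists_rep (s a)
    refine ⟨extend a d σ, fun x hx => ?_⟩
    rw [lookup_extend]
    by_cases h : x = a
    · subst h
      rw [Function.update_self, hd]
    · rw [Function.update_of_ne h]
      exact hσ x (Finset.mem_of_mem_insert_of_ne hx h)

theorem satK_iff {s : ℕ → hv.model.U} {φ : LFormula} {σ : ℕ}
    (hσ : ∀ x ∈ φ.fv, s x = Quotient.mk hv.setoid (lookup σ x)) :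
    hv.model.satK s φ ↔ v (atSat (fmK φ.gnum) σ) := by
  refine ⟨fun ⟨τ, hτ, h⟩ => ?_, fun h => ⟨σ, hσ, h⟩⟩
  exact hv .satAgree _ τ σ 0 0 0
    (hv.form_agree fun x hx => Quotient.exact ((hτ x hx).symm.trans (hσ x hx))) h

theorem update_eq_lookup {s : ℕ → hv.model.U} {σ x d : ℕ} {S : Finset ℕ}
    (hσ : ∀ y ∈ S, y ≠ x → s y = Quotient.mk hv.setoid (lookup σ y)) :
    ∀ y ∈ S, Function.update s x (Quotient.mk hv.setoid d) y =
      Quotient.mk hv.setoid (lookup (extend x d σ) y) := by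
  intro y hy
  rw [lookup_extend]
  by_cases h : y = x
  · subst h
    rw [Function.update_self]
    exact Function.update_self y _ s
  · rw [Function.update_of_ne h]
    exact (Function.update_of_ne h _ s).trans (hσ y hy h)

theorem isLStructure_model : IsLStructure hv.model := by
  refine ⟨fun φ s t h => ?_, fun φ ψ s h => ?_, fun φ x y s h => ?_⟩
  · obtain ⟨σ, hσ⟩ := hv.exists_env s φ.fv
    rw [hv.satK_iff hσ, hv.satK_iff fun x hx => (h x hx).symm.trans (hσ x hx)]
  · obtain ⟨σ, hσ⟩ := hv.exists_env s (φ.fv ∪ ψ.fv)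
    rw [hv.satK_iff fun x hx => hσ x (Finset.mem_union_left _ hx),
      hv.satK_iff fun x hx => hσ x (Finset.mem_union_right _ hx)]
    exact ⟨hv .satAlpha _ _ σ 0 0 0 (hv.form_alpha h), hv .alphaSat _ _ σ 0 0 0 (hv.form_alpha h)⟩
  · obtain ⟨σ, hσ⟩ := hv.exists_env s (insert y (φ.fv ∪ (subst1 x (.var y) φ).fv))
    rw [hσ y (Finset.mem_insert_self _ _), hv.satK_iff fun z hz => hσ z
        (Finset.mem_insert_of_mem (Finset.mem_union_right _ hz)),
      hv.satK_iff (hv.update_eq_lookup fun z hz _ => hσ z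
        (Finset.mem_insert_of_mem (Finset.mem_union_left _ hz)))]
    exact ⟨hv .satSub _ _ _ _ _ σ (hv.form_subst h) (hv.val_lookup σ y),
      hv .subSat _ _ _ _ _ σ (hv.form_subst h) (hv.val_lookup σ y)⟩

theorem evalT_model {s : ℕ → hv.model.U} {σ : ℕ} {t : LTerm}
    (hσ : ∀ x ∈ t.fv, s x = Quotient.mk hv.setoid (lookup σ x)) :
    hv.model.evalT s t = Quotient.mk hv.setoid (termName σ t) := by
  induction t with
  | var x => exact hσ x (by simp [LTerm.fv])
  | zero => rfl
  | succ t ih => rw [LStructure.evalT, ih hσ]; rfl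
  | add t u ih ih' | mul t u ih ih' =>
    simp only [LTerm.fv, Finset.mem_union] at hσ
    rw [LStructure.evalT, ih fun x hx => hσ x (.inl hx), ih' fun x hx => hσ x (.inr hx)]
    rfl

/-- The atoms for satisfaction express satisfaction in the structure of names. -/
theorem sat_model_iff {φ : LFormula} {s : ℕ → hv.model.U} {σ : ℕ}
    (hσ : ∀ x ∈ φ.fv, s x = Quotient.mk hv.setoid (lookup σ x)) :
    hv.model.Sat s φ ↔ v (atSat φ.gnum σ) := by
  induction φ generalizing s σ with
  | eq t u =>
    simp only [LFormula.fv, Finset.mem_union] at hσ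
    rw [LStructure.Sat, hv.evalT_model fun x hx => hσ x (.inl hx),
      hv.evalT_model fun x hx => hσ x (.inr hx)]
    refine Quotient.eq.trans ⟨fun h => ?_, fun h => ?_⟩
    · exact hv .eqSat _ _ _ _ σ 0 (hv.val_termName σ t) (hv.val_termName σ u) h
    · exact hv .satEq _ _ _ _ σ 0 (hv.val_termName σ t) (hv.val_termName σ u) h
  | falsum => exact ⟨False.elim, hv .satFalsum σ 0 0 0 0 0⟩
  | imp a b ih ih' =>
    simp only [LFormula.fv, Finset.mem_union] at hσ
    rw [LStructure.Sat, ih fun x hx => hσ x (.inl hx), ih' fun x hx => hσ x (.inr hx)]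
    refine ⟨fun h => ?_, hv .impElim _ _ σ 0 0 0⟩
    rcases hv .impCases a.gnum b.gnum σ 0 0 0 (hv.isForm a) (hv.isForm b) with h' | h'
    · exact h'
    · exact hv .impIntro _ _ σ 0 0 0 (hv.isForm a) (h h')
  | all x a ih =>
    have key (d : ℕ) : hv.model.Sat (Function.update s x (Quotient.mk hv.setoid d)) a ↔
        v (atSat a.gnum (extend x d σ)) :=
      ih (hv.update_eq_lookup fun y hy hyx => hσ y (Finset.mem_erase.2 ⟨hyx, hy⟩))
    rw [LStructure.Sat]
    refine ⟨fun h => hv .allIntro x _ σ 0 0 0 ((key _).1 (h _)), fun h u => ?_⟩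
    obtain ⟨d, rfl⟩ := Quotient.exists_rep u
    exact (key d).2 (hv .allElim x _ d σ 0 0 h)
  | K a => exact hv.satK_iff hσ

end Closed

/-! ### Consequence and satisfiability -/

/-- A formula is not a consequence of `T` exactly when the clauses expressing this are
satisfiable; and the clauses associated with numbers that are not codes of formulas are. -/
theorem exists_closed_iff {T : Set LFormula} {k : ℕ} :
    (∃ v, Closed v ∧ ¬ v (atSat k 0) ∧ ∀ t, (∃ φ ∈ T, t = φ.gnum) → v (atIsForm k) →
      ∀ e, v (atSat t e)) ↔ ¬ ∃ φ, Consequence T φ ∧ k = φ.gnum := by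
  constructor
  · rintro ⟨v, hv, hk, hT⟩ ⟨φ, hφ, rfl⟩
    refine hk ((hv.sat_model_iff (s := fun x => Quotient.mk _ (lookup 0 x))
      fun _ _ => rfl).1 (hφ hv.model hv.isLStructure_model (fun ψ hψ s => ?_) _))
    obtain ⟨σ, hσ⟩ := hv.exists_env s ψ.fv
    exact (hv.sat_model_iff hσ).2 (hT _ ⟨ψ, hψ, rfl⟩ (hv.isForm φ) σ)
  · intro h
    by_cases hk : ∃ φ : LFormula, k = φ.gnum
    · obtain ⟨φ, rfl⟩ := hk
      have hφ : ¬ Consequence T φ := fun hφ => h ⟨φ, hφ, rfl⟩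
      simp only [Consequence, LStructure.Models, not_forall] at hφ
      obtain ⟨M, hM, hT, s, hs⟩ := hφ
      refine ⟨val M s, closed_val hM s, ?_, ?_⟩
      · rwa [val_sat_gnum, env_zero]
      · rintro _ ⟨ψ, hψ, rfl⟩ - e
        exact (val_sat_gnum M s).2 (hT ψ hψ _)
    · let M : LStructure := ⟨Unit, ⟨()⟩, (), fun _ => (), fun _ _ => (), fun _ _ => (),
        fun _ _ => False⟩
      have hM : IsLStructure M :=
        ⟨fun _ _ _ _ => Iff.rfl, fun _ _ _ _ => Iff.rfl, fun _ _ _ _ _ => Iff.rfl⟩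
      refine ⟨val M fun _ => (), closed_val hM _, ?_, fun t _ hf => ?_⟩
      · rw [val_sat]
        exact fun ⟨φ, hφ, _⟩ => hk ⟨φ, hφ.symm⟩
      · rw [val_form] at hf
        obtain ⟨φ, -, hφ, -⟩ := hf
        exact absurd ⟨φ, hφ.symm⟩ hk

end Henkin

/-- For any recursively enumerable set Σ of 𝓛-sentences, the set
`{φ : Σ ⊨ φ}` of 𝓛-formulas that are logical consequences of Σ is recursively
enumerable. -/
theorem consequences_re (T : Set LFormula) (hsent : ∀ φ ∈ T, φ.fv = ∅)
    (hre : ∃ e : ℕ, W e = {k : ℕ | ∃ φ ∈ T, k = φ.gnum}) :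
    ∃ e : ℕ, W e = {k : ℕ | ∃ φ : LFormula, Consequence T φ ∧ k = φ.gnum} := by
  obtain ⟨e, he⟩ := hre
  obtain ⟨g, hg, hv⟩ := Henkin.exists_primrec_closed
  obtain ⟨c, hc⟩ := Clause.exists_code_unsatisfiable
    (Henkin.primrec_theoryClause hg (Denumerable.ofNat Nat.Partrec.Code e))
  have he' (t : ℕ) : ((Denumerable.ofNat Nat.Partrec.Code e).eval t).Dom ↔
      ∃ φ ∈ T, t = φ.gnum := Set.ext_iff.1 he t
  refine ⟨Encodable.encode c, Set.ext fun k => ?_⟩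
  simp only [W, Denumerable.ofNat_encode, Set.mem_ofPred_eq, hc,
    Henkin.forall_holds_theoryClause (hv _), he', Henkin.exists_closed_iff, not_not]
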